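/- arXiv:2602.19234 — 14 statements merged into one kernel-verified Lean document; each statement's English description precedes it below -/
import Mathlib

section
/- Every spectral projection P_m (1 ≤ m ≤ M) is a polynomial filter; that is, P_m belongs to the unital ℝ-subalgebra of V×V matrices generated by {S_1, …, S_d}. -/
open Matrix

theorem stmt1
    {V : Type*} [Fintype V] [DecidableEq V] [Nonempty V]
    (hN : 2 ≤ Fintype.card V)
    {d M : ℕ} (hd : 1 ≤ d) (hM : 1 ≤ M)
    (S : Fin d → Matrix V V ℝ)
    (hSsym : ∀ l, (S l)ᵀ = S l)
    (hScomm : ∀ l l', S l * S l' = S l' * S l)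
    (γ : Fin M → Fin d → ℝ) (hγ : Function.Injective γ)
    (P : Fin M → Matrix V V ℝ)
    (hPne : ∀ m, P m ≠ 0)
    (hPsym : ∀ m, (P m)ᵀ = P m)
    (hPidem : ∀ m, P m * P m = P m)
    (hPorth : ∀ m m', m ≠ m' → P m * P m' = 0)
    (hPsum : ∑ m, P m = (1 : Matrix V V ℝ))
    (hSP : ∀ l m, S l * P m = γ m l • P m)
    (hPS : ∀ l m, P m * S l = γ m l • P m)
    : ∀ m, P m ∈ Algebra.adjoin ℝ (Set.range S) := by
  intro m
  have key : ∀ T : Finset (Fin M), m ∉ T → ∃ A ∈ Algebra.adjoin ℝ (Set.range S),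
      ∃ c : Fin M → ℝ, (∀ k, A * P k = c k • P k) ∧ c m = 1 ∧ ∀ k ∈ T, c k = 0 := by
    intro T
    induction T using Finset.induction_on with
    | empty =>
      intro _
      exact ⟨1, Subalgebra.one_mem _, fun _ => 1, by simp, rfl, by simp⟩
    | insert k T hk ih =>
      intro hm
      rw [Finset.mem_insert, not_or] at hm
      obtain ⟨A, hA, c, hc, hcm, hcT⟩ := ih hm.2
      obtain ⟨l, hl⟩ : ∃ l, γ m l ≠ γ k l := by
        by_contra! h
        exact hm.1 (hγ (funext h))
      have hl' : γ m l - γ k l ≠ 0 := sub_ne_zero.mpr hl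
      refine ⟨((γ m l - γ k l)⁻¹ • (S l - γ k l • (1 : Matrix V V ℝ))) * A, ?_,
        fun j => (γ m l - γ k l)⁻¹ * (γ j l - γ k l) * c j, ?_, ?_, ?_⟩
      · refine Subalgebra.mul_mem _ (Subalgebra.smul_mem _ (Subalgebra.sub_mem _ ?_ ?_) _) hA
        · exact Algebra.subset_adjoin ⟨l, rfl⟩
        · exact Subalgebra.smul_mem _ (Subalgebra.one_mem _) _
      · intro j
        rw [mul_assoc, hc j, mul_smul_comm, smul_mul_assoc, sub_mul, hSP, smul_mul_assoc, one_mul,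
          ← sub_smul, smul_smul, smul_smul]
        congr 1
        ring
      · simp [hcm, hl']
      · intro j hj
        rcases Finset.mem_insert.mp hj with rfl | hj
        · simp
        · simp [hcT j hj]
  obtain ⟨A, hA, c, hc, hcm, hcT⟩ := key (Finset.univ.erase m) (by simp)
  have hAP : A = P m := by
    rw [← mul_one A, ← hPsum, Finset.mul_sum, Finset.sum_eq_single m]
    · rw [hc, hcm, one_smul]
    · intro j _ hj
      rw [hc, hcT j (by simp [hj]), zero_smul]
    · simp
  exact hAP ▸ hA
end

section
/- For a real V×V matrix H, the following are equivalent: (a) H is a shift-invariant filter and H G = G H for every shift-invariant filter G; (b) H is a polynomial filter. In other words, the center of the unital semigroup of shift-invariant filters is exactly the set of polynomial filters. -/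
open Matrix

theorem stmt4
    {V : Type*} [Fintype V] [DecidableEq V] [Nonempty V]
    (hN : 2 ≤ Fintype.card V)
    {d M : ℕ} (hd : 1 ≤ d) (hM : 1 ≤ M)
    (S : Fin d → Matrix V V ℝ)
    (hSsym : ∀ l, (S l)ᵀ = S l)
    (hScomm : ∀ l l', S l * S l' = S l' * S l)
    (γ : Fin M → Fin d → ℝ) (hγ : Function.Injective γ)
    (P : Fin M → Matrix V V ℝ)
    (hPne : ∀ m, P m ≠ 0)
    (hPsym : ∀ m, (P m)ᵀ = P m)
    (hPidem : ∀ m, P m * P m = P m)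
    (hPorth : ∀ m m', m ≠ m' → P m * P m' = 0)
    (hPsum : ∑ m, P m = (1 : Matrix V V ℝ))
    (hSP : ∀ l m, S l * P m = γ m l • P m)
    (hPS : ∀ l m, P m * S l = γ m l • P m)
    (H : Matrix V V ℝ) :
    ((∀ l, H * S l = S l * H) ∧
        ∀ G : Matrix V V ℝ, (∀ l, G * S l = S l * G) → H * G = G * H)
      ↔ H ∈ Algebra.adjoin ℝ (Set.range S) := by
  constructor
  · rintro ⟨-, hH⟩
    -- each projection is a polynomial filter
    have sep : ∀ (m : Fin M) (s : Finset (Fin M)), m ∉ s →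
        ∃ q ∈ Algebra.adjoin ℝ (Set.range S), q * P m = P m ∧ ∀ a ∈ s, q * P a = 0 := by
      intro m s
      induction s using Finset.induction_on with
      | empty => intro _; exact ⟨1, one_mem _, one_mul _, by simp⟩
      | insert a s has ih =>
        intro hm
        rw [Finset.mem_insert, not_or] at hm
        obtain ⟨q, hq, hqm, hqs⟩ := ih hm.2
        have hne : γ m ≠ γ a := fun h => hm.1 (hγ h)
        obtain ⟨l, hl⟩ := Function.ne_iff.mp hne
        have hl' : γ m l - γ a l ≠ 0 := sub_ne_zero.mpr hl
        have key : ∀ b, (q * ((γ m l - γ a l)⁻¹ • (S l - γ a l • (1 : Matrix V V ℝ)))) * P b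
            = ((γ m l - γ a l)⁻¹ * (γ b l - γ a l)) • (q * P b) := by
          intro b
          rw [mul_assoc, smul_mul_assoc, sub_mul, hSP, smul_mul_assoc, one_mul, ← sub_smul,
            smul_smul, mul_smul_comm]
        refine ⟨_, mul_mem hq (Subalgebra.smul_mem _ (sub_mem
          (Algebra.subset_adjoin (Set.mem_range_self l)) (Subalgebra.smul_mem _ (one_mem _) (γ a l)))
          (γ m l - γ a l)⁻¹), ?_, ?_⟩
        · rw [key, inv_mul_cancel₀ hl', one_smul, hqm]
        · intro b hb
          rw [key]
          rcases Finset.mem_insert.mp hb with rfl | hb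
          · simp
          · rw [hqs b hb, smul_zero]
    have hPmem : ∀ m, P m ∈ Algebra.adjoin ℝ (Set.range S) := by
      intro m
      obtain ⟨q, hq, hqm, hqs⟩ := sep m (Finset.univ.erase m) (by simp)
      have : q = P m := by
        rw [← mul_one q, ← hPsum, Finset.mul_sum, Finset.sum_eq_single m, hqm]
        · intro b _ hb
          exact hqs b (by simp [hb])
        · simp
      exact this ▸ hq
    have hHP : ∀ m, H * P m = P m * H := fun m => hH _ fun l => by rw [hPS, hSP]
    have hsc : ∀ m, ∃ c : ℝ, H * P m = c • P m := by
      intro m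
      have hX : ∀ X, H * P m * X * P m = P m * X * (H * P m) := by
        intro X
        have h := hH (P m * X * P m) fun l => by
          rw [mul_assoc, hPS, ← mul_assoc, ← mul_assoc, hSP]
          simp
        rw [hHP m, ← mul_assoc, ← h, ← hHP m]
        simp only [mul_assoc]
      obtain ⟨j, b, hjb⟩ : ∃ j b, P m j b ≠ 0 := by
        by_contra! h
        exact hPne m (by ext j b; exact h j b)
      refine ⟨(H * P m) j b / P m j b, ?_⟩
      ext a i
      have h := congrFun (congrFun (hX (vecMulVec (Pi.single i 1) (Pi.single j 1))) a) b
      rw [mul_vecMulVec, mul_vecMulVec, vecMulVec_mul, vecMulVec_mul] at h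
      simp only [vecMulVec_apply, mulVec_single_one, single_one_vecMul, col_apply, row_apply] at h
      rw [Matrix.smul_apply, smul_eq_mul]
      field_simp
      linarith
    choose c hc using hsc
    have : H = ∑ m, c m • P m := by
      rw [← mul_one H, ← hPsum, Finset.mul_sum]
      exact Finset.sum_congr rfl fun m _ => hc m
    rw [this]
    exact sum_mem fun m _ => Subalgebra.smul_mem _ (hPmem m) _
  · intro hH
    have h2 : ∀ G : Matrix V V ℝ, (∀ l, G * S l = S l * G) → H * G = G * H := by
      intro G hG
      have h := Algebra.adjoin_le_centralizer_centralizer ℝ _ hH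
      refine (Subalgebra.mem_centralizer_iff ℝ).mp h G ?_ |>.symm
      refine (Subalgebra.mem_centralizer_iff ℝ).mpr ?_
      rintro _ ⟨l, rfl⟩
      exact (hG l).symm
    exact ⟨fun l => h2 _ fun l' => hScomm l l', h2⟩
end

section
/- Suppose in addition that every spectral projection P_m has rank 1 (equivalently, the joint spectrum of S_1, …, S_d consists of N pairwise distinct joint-eigenvalue vectors, so M = N). Then every shift-invariant filter is a polynomial filter: any real V×V matrix H satisfying H S_l = S_l H for all 1 ≤ l ≤ d belongs to the unital ℝ-subalgebra of V×V matrices generated by {S_1, …, S_d}. -/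
open Matrix

theorem rank_one_compress {V : Type*} [Fintype V] [DecidableEq V]
    (P H : Matrix V V ℝ) (h : P.rank = 1) : ∃ c : ℝ, P * H * P = c • P := by
  obtain ⟨v, -, hv⟩ := finrank_eq_one_iff'.mp h
  have hcol : ∀ j, ∃ c : ℝ, c • (v : V → ℝ) = P *ᵥ (Pi.single j 1) := by
    intro j
    obtain ⟨c, hc⟩ := hv ⟨P *ᵥ (Pi.single j 1), ⟨Pi.single j 1, rfl⟩⟩
    exact ⟨c, congrArg Subtype.val hc⟩
  choose w hw using hcol
  have hP : P = vecMulVec (v : V → ℝ) w := by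
    ext i j
    have := congrFun (hw j) i
    simp at this
    rw [vecMulVec_apply, ← this, mul_comm]
  refine ⟨w ⬝ᵥ (H *ᵥ (v : V → ℝ)), ?_⟩
  clear hw
  generalize (v : V → ℝ) = u at hP ⊢
  rw [hP, Matrix.mul_assoc, mul_vecMulVec, vecMulVec_mul_vecMulVec]
  ext i j
  simp [vecMulVec_apply]
  try ring

theorem stmt5
    {V : Type*} [Fintype V] [DecidableEq V] [Nonempty V]
    (hN : 2 ≤ Fintype.card V)
    {d M : ℕ} (hd : 1 ≤ d) (hM : 1 ≤ M)
    (S : Fin d → Matrix V V ℝ)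
    (hSsym : ∀ l, (S l)ᵀ = S l)
    (hScomm : ∀ l l', S l * S l' = S l' * S l)
    (γ : Fin M → Fin d → ℝ) (hγ : Function.Injective γ)
    (P : Fin M → Matrix V V ℝ)
    (hPne : ∀ m, P m ≠ 0)
    (hPsym : ∀ m, (P m)ᵀ = P m)
    (hPidem : ∀ m, P m * P m = P m)
    (hPorth : ∀ m m', m ≠ m' → P m * P m' = 0)
    (hPsum : ∑ m, P m = (1 : Matrix V V ℝ))
    (hSP : ∀ l m, S l * P m = γ m l • P m)
    (hPS : ∀ l m, P m * S l = γ m l • P m)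
    (hrank : ∀ m, (P m).rank = 1) :
    ∀ H : Matrix V V ℝ, (∀ l, H * S l = S l * H) →
      H ∈ Algebra.adjoin ℝ (Set.range S) := by
  intro H hH
  have key : ∀ m, ∀ T : Finset (Fin M), m ∉ T →
      ∃ Q ∈ Algebra.adjoin ℝ (Set.range S), Q * P m = P m ∧ ∀ k ∈ T, Q * P k = 0 := by
    intro m T
    induction T using Finset.induction_on with
    | empty => intro _; exact ⟨1, one_mem _, by simp, by simp⟩
    | insert a T ha ih =>
      intro hm
      rw [Finset.mem_insert, not_or] at hm
      obtain ⟨Q, hQ, hQm, hQT⟩ := ih hm.2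
      obtain ⟨l, hl⟩ : ∃ l, γ m l ≠ γ a l := by
        by_contra hcon
        push Not at hcon
        exact hm.1 (hγ (funext hcon))
      have hact : ∀ k, Q * ((γ m l - γ a l)⁻¹ • (S l - γ a l • 1)) * P k
          = ((γ m l - γ a l)⁻¹ * (γ k l - γ a l)) • (Q * P k) := by
        intro k
        rw [Matrix.mul_assoc, smul_mul_assoc, sub_mul, hSP, smul_mul_assoc, one_mul,
          ← sub_smul, smul_smul, mul_smul_comm]
      refine ⟨_, mul_mem hQ (Subalgebra.smul_mem _ (sub_mem (Algebra.subset_adjoin (Set.mem_range_self l))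
        (Subalgebra.smul_mem _ (one_mem _) (γ a l))) (γ m l - γ a l)⁻¹), ?_, ?_⟩
      · rw [hact, inv_mul_cancel₀ (sub_ne_zero.mpr hl), one_smul, hQm]
      · intro k hk
        rw [hact]
        rcases Finset.mem_insert.mp hk with rfl | hk
        · simp
        · rw [hQT k hk, smul_zero]
  have hPA : ∀ m, P m ∈ Algebra.adjoin ℝ (Set.range S) := by
    intro m
    obtain ⟨Q, hQ, hQm, hQT⟩ := key m (Finset.univ.erase m) (by simp)
    have : Q = P m := by
      rw [← mul_one Q, ← hPsum, Finset.mul_sum, Finset.sum_eq_single m, hQm]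
      · intro k _ hk
        exact hQT k (by simp [hk])
      · simp
    rwa [← this]
  have hHP : ∀ m, H * P m = P m * H := by
    intro m
    refine Algebra.adjoin_induction (p := fun X _ => H * X = X * H) ?_ ?_ ?_ ?_ (hPA m)
    · rintro _ ⟨l, rfl⟩
      exact hH l
    · intro r
      exact (Algebra.commutes r H).symm
    · intro x y _ _ hx hy
      rw [mul_add, add_mul, hx, hy]
    · intro x y _ _ hx hy
      rw [← mul_assoc, hx, mul_assoc, hy, mul_assoc]
  rw [← mul_one H, ← hPsum, Finset.mul_sum]
  refine sum_mem fun m _ => ?_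
  obtain ⟨c, hc⟩ := rank_one_compress (P m) H (hrank m)
  have : H * P m = c • P m := by
    rw [← hc, ← hHP, mul_assoc, hPidem]
  rw [this]
  exact Subalgebra.smul_mem _ (hPA m) c
end

section
/- A subspace (submodule) U ⊆ ℝ^V is shift-invariant if and only if there exist subspaces J_1, …, J_M ⊆ ℝ^V (a graph range function) such that U = { x ∈ ℝ^V : P_m x ∈ J_m for all 1 ≤ m ≤ M }. -/
open Matrix

theorem stmt6
    {V : Type*} [Fintype V] [DecidableEq V] [Nonempty V]
    (hN : 2 ≤ Fintype.card V)
    {d M : ℕ} (hd : 1 ≤ d) (hM : 1 ≤ M)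
    (S : Fin d → Matrix V V ℝ)
    (hSsym : ∀ l, (S l)ᵀ = S l)
    (hScomm : ∀ l l', S l * S l' = S l' * S l)
    (γ : Fin M → Fin d → ℝ) (hγ : Function.Injective γ)
    (P : Fin M → Matrix V V ℝ)
    (hPne : ∀ m, P m ≠ 0)
    (hPsym : ∀ m, (P m)ᵀ = P m)
    (hPidem : ∀ m, P m * P m = P m)
    (hPorth : ∀ m m', m ≠ m' → P m * P m' = 0)
    (hPsum : ∑ m, P m = (1 : Matrix V V ℝ))
    (hSP : ∀ l m, S l * P m = γ m l • P m)
    (hPS : ∀ l m, P m * S l = γ m l • P m)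
    (U : Submodule ℝ (V → ℝ)) :
    (∀ l : Fin d, ∀ x ∈ U, (S l) *ᵥ x ∈ U) ↔
      ∃ J : Fin M → Submodule ℝ (V → ℝ),
        ∀ x : V → ℝ, x ∈ U ↔ ∀ m, (P m) *ᵥ x ∈ J m := by
  have hPSx : ∀ l m (x : V → ℝ), P m *ᵥ (S l *ᵥ x) = γ m l • (P m *ᵥ x) := by
    intro l m x
    rw [Matrix.mulVec_mulVec, hPS, Matrix.smul_mulVec]
  have hsum : ∀ x : V → ℝ, ∑ m, P m *ᵥ x = x := by
    intro x
    rw [← Matrix.sum_mulVec, hPsum, Matrix.one_mulVec]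
  constructor
  · intro hU
    refine ⟨fun _ => U, fun x => ⟨fun hx m => ?_, fun h => ?_⟩⟩
    · have key : ∀ T : Finset (Fin M), m ∉ T →
          ∃ y ∈ U, P m *ᵥ y = P m *ᵥ x ∧ ∀ k ∈ T, P k *ᵥ y = 0 := by
        intro T
        induction T using Finset.induction_on with
        | empty => exact fun _ => ⟨x, hx, rfl, by simp⟩
        | insert k T hk ih =>
          intro hm
          rw [Finset.mem_insert, not_or] at hm
          obtain ⟨y, hyU, hy, hT⟩ := ih hm.2
          obtain ⟨l, hl⟩ := Function.ne_iff.mp (hγ.ne hm.1)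
          have hl' : γ m l - γ k l ≠ 0 := sub_ne_zero.mpr hl
          have hP : ∀ j, P j *ᵥ ((γ m l - γ k l)⁻¹ • (S l *ᵥ y - γ k l • y)) =
              ((γ m l - γ k l)⁻¹ * (γ j l - γ k l)) • (P j *ᵥ y) := by
            intro j
            rw [Matrix.mulVec_smul, Matrix.mulVec_sub, Matrix.mulVec_smul, hPSx, ← sub_smul,
              smul_smul]
          refine ⟨(γ m l - γ k l)⁻¹ • (S l *ᵥ y - γ k l • y),
            U.smul_mem _ (U.sub_mem (hU l y hyU) (U.smul_mem _ hyU)), ?_, ?_⟩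
          · rw [hP, inv_mul_cancel₀ hl', one_smul, hy]
          · intro j hj
            rw [hP]
            rcases Finset.mem_insert.mp hj with rfl | hj
            · simp
            · rw [hT j hj, smul_zero]
      obtain ⟨y, hyU, hy, h0⟩ := key (Finset.univ.erase m) (by simp)
      have : y = P m *ᵥ x := by
        rw [← hy]
        conv_lhs => rw [← hsum y]
        exact Finset.sum_eq_single m (fun k _ hk => h0 k (by simp [hk])) (by simp)
      exact this ▸ hyU
    · rw [← hsum x]
      exact U.sum_mem fun m _ => h m
  · rintro ⟨J, hJ⟩ l x hx
    rw [hJ] at hx ⊢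
    intro m
    rw [hPSx]
    exact (J m).smul_mem _ (hx m)
end

section
/- For a subspace U ⊆ ℝ^V the following are equivalent: (a) U is shift-invariant; (b) there is a shift-invariant filter H with U = { H x : x ∈ ℝ^V } (the range of x ↦ H x); (c) there is a shift-invariant filter G with U = { x ∈ ℝ^V : G x = 0 } (the kernel of x ↦ G x). -/
open Matrix

/-- A projection matrix onto an invariant subspace which commutes with the symmetric shifts. -/
theorem exists_commuting_projection {V ι : Type*} [Fintype V] [DecidableEq V]
    (S : ι → Matrix V V ℝ) (hS : ∀ l, (S l)ᵀ = S l) (U : Submodule ℝ (V → ℝ))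
    (hU : ∀ l, ∀ x ∈ U, (S l) *ᵥ x ∈ U) :
    ∃ Q : Matrix V V ℝ, (∀ l, Q * S l = S l * Q) ∧ (∀ x, Q *ᵥ x ∈ U) ∧
      (∀ x ∈ U, Q *ᵥ x = x) := by
  let B : LinearMap.BilinForm ℝ (V → ℝ) := dotProductBilin ℝ ℝ
  have hB : ∀ x y, B x y = x ⬝ᵥ y := fun _ _ => rfl
  have hrefl : B.IsRefl := by
    intro x y h
    rw [hB] at h ⊢
    rw [dotProduct_comm, h]
  have hc : IsCompl U (B.orthogonal U) := by
    rw [LinearMap.BilinForm.isCompl_orthogonal_iff_disjoint hrefl, Submodule.disjoint_def]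
    intro x hx hx'
    have h := hx' x hx
    exact dotProduct_self_eq_zero.1 h
  have hW : ∀ l, ∀ x ∈ B.orthogonal U, S l *ᵥ x ∈ B.orthogonal U := by
    intro l x hx y hy
    have h : B (S l *ᵥ y) x = 0 := hx _ (hU l y hy)
    change B y (S l *ᵥ x) = 0
    rw [hB] at h ⊢
    rw [dotProduct_mulVec, ← mulVec_transpose, hS, h]
  let p := U.projection (B.orthogonal U) hc
  have hp : ∀ x, LinearMap.toMatrix' p *ᵥ x = p x := fun x => LinearMap.toMatrix'_mulVec p x
  refine ⟨LinearMap.toMatrix' p, ?_, ?_, ?_⟩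
  · intro l
    apply Matrix.ext_of_mulVec_single
    intro i
    generalize (Pi.single i (1 : ℝ) : V → ℝ) = x
    rw [← mulVec_mulVec, ← mulVec_mulVec, hp, hp]
    have h1 : p (S l *ᵥ p x) = S l *ᵥ p x :=
      Submodule.projection_apply_of_mem_left hc (hU l _ (Submodule.projection_apply_mem hc x))
    have h2 : p (S l *ᵥ (x - p x)) = 0 :=
      (Submodule.projection_apply_eq_zero_iff hc).2 (hW l _ (Submodule.sub_projection_mem hc x))
    rw [mulVec_sub, map_sub, h1, sub_eq_zero] at h2
    exact h2
  · intro x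
    rw [hp]
    exact Submodule.projection_apply_mem hc x
  · intro x hx
    rw [hp]
    exact Submodule.projection_apply_of_mem_left hc hx

theorem stmt7
    {V : Type*} [Fintype V] [DecidableEq V] [Nonempty V]
    (hN : 2 ≤ Fintype.card V)
    {d M : ℕ} (hd : 1 ≤ d) (hM : 1 ≤ M)
    (S : Fin d → Matrix V V ℝ)
    (hSsym : ∀ l, (S l)ᵀ = S l)
    (hScomm : ∀ l l', S l * S l' = S l' * S l)
    (γ : Fin M → Fin d → ℝ) (hγ : Function.Injective γ)
    (P : Fin M → Matrix V V ℝ)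
    (hPne : ∀ m, P m ≠ 0)
    (hPsym : ∀ m, (P m)ᵀ = P m)
    (hPidem : ∀ m, P m * P m = P m)
    (hPorth : ∀ m m', m ≠ m' → P m * P m' = 0)
    (hPsum : ∑ m, P m = (1 : Matrix V V ℝ))
    (hSP : ∀ l m, S l * P m = γ m l • P m)
    (hPS : ∀ l m, P m * S l = γ m l • P m)
    (U : Submodule ℝ (V → ℝ)) :
    ((∀ l : Fin d, ∀ x ∈ U, (S l) *ᵥ x ∈ U) ↔
      ∃ H : Matrix V V ℝ, (∀ l, H * S l = S l * H) ∧
        U = LinearMap.range H.mulVecLin)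
    ∧ ((∀ l : Fin d, ∀ x ∈ U, (S l) *ᵥ x ∈ U) ↔
      ∃ G : Matrix V V ℝ, (∀ l, G * S l = S l * G) ∧
        U = LinearMap.ker G.mulVecLin) := by
  refine ⟨⟨fun h => ?_, ?_⟩, ⟨fun h => ?_, ?_⟩⟩
  · obtain ⟨Q, hQ, hm, hf⟩ := exists_commuting_projection S hSsym U h
    refine ⟨Q, hQ, le_antisymm (fun x hx => ⟨x, hf x hx⟩) ?_⟩
    rintro _ ⟨x, rfl⟩
    exact hm x
  · rintro ⟨H, hH, rfl⟩ l _ ⟨x, rfl⟩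
    refine ⟨S l *ᵥ x, ?_⟩
    simp only [mulVecLin_apply, mulVec_mulVec, hH]
  · obtain ⟨Q, hQ, hm, hf⟩ := exists_commuting_projection S hSsym U h
    refine ⟨1 - Q, fun l => by rw [sub_mul, mul_sub, hQ, one_mul, mul_one], ?_⟩
    ext x
    rw [LinearMap.mem_ker, mulVecLin_apply, sub_mulVec, one_mulVec, sub_eq_zero]
    exact ⟨fun hx => (hf x hx).symm, fun hx => hx ▸ hm x⟩
  · rintro ⟨G, hG, rfl⟩ l x hx
    rw [LinearMap.mem_ker, mulVecLin_apply] at hx ⊢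
    rw [mulVec_mulVec, hG, ← mulVec_mulVec, hx, mulVec_zero]
end

section
/- Call a subspace U ⊆ ℝ^V bandlimited if there is a set Ω ⊆ {1,…,M} with U = { x ∈ ℝ^V : P_m x = 0 for all m ∉ Ω }, and super-shift-invariant if H x ∈ U for every shift-invariant filter H and every x ∈ U. Then a subspace U ⊆ ℝ^V is super-shift-invariant if and only if it is bandlimited. -/
open Matrix

theorem stmt8
    {V : Type*} [Fintype V] [DecidableEq V] [Nonempty V]
    (hN : 2 ≤ Fintype.card V)
    {d M : ℕ} (hd : 1 ≤ d) (hM : 1 ≤ M)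
    (S : Fin d → Matrix V V ℝ)
    (hSsym : ∀ l, (S l)ᵀ = S l)
    (hScomm : ∀ l l', S l * S l' = S l' * S l)
    (γ : Fin M → Fin d → ℝ) (hγ : Function.Injective γ)
    (P : Fin M → Matrix V V ℝ)
    (hPne : ∀ m, P m ≠ 0)
    (hPsym : ∀ m, (P m)ᵀ = P m)
    (hPidem : ∀ m, P m * P m = P m)
    (hPorth : ∀ m m', m ≠ m' → P m * P m' = 0)
    (hPsum : ∑ m, P m = (1 : Matrix V V ℝ))
    (hSP : ∀ l m, S l * P m = γ m l • P m)
    (hPS : ∀ l m, P m * S l = γ m l • P m)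
    (U : Submodule ℝ (V → ℝ)) :
    (∀ H : Matrix V V ℝ, (∀ l, H * S l = S l * H) → ∀ x ∈ U, H *ᵥ x ∈ U) ↔
      ∃ Ω : Finset (Fin M), ∀ x : V → ℝ, x ∈ U ↔ ∀ m ∉ Ω, (P m) *ᵥ x = 0 := by
  classical
  have hdecomp : ∀ x : V → ℝ, x = ∑ m, P m *ᵥ x := by
    intro x
    rw [← Matrix.sum_mulVec, hPsum, Matrix.one_mulVec]
  constructor
  · intro hU
    refine ⟨Finset.univ.filter (fun m => ∃ u ∈ U, P m *ᵥ u ≠ 0), fun x => ⟨?_, ?_⟩⟩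
    · intro hx m hm
      by_contra hne
      exact hm (Finset.mem_filter.mpr ⟨Finset.mem_univ _, x, hx, hne⟩)
    · intro hx
      rw [hdecomp x]
      refine Submodule.sum_mem _ fun m _ => ?_
      by_cases hm : m ∈ Finset.univ.filter (fun m => ∃ u ∈ U, P m *ᵥ u ≠ 0)
      · obtain ⟨-, u, hu, hne⟩ := Finset.mem_filter.mp hm
        have key := hU (P m * Matrix.vecMulVec x (P m *ᵥ u) * P m) (by
          intro l
          rw [Matrix.mul_assoc, hPS, ← Matrix.mul_assoc, ← Matrix.mul_assoc, hSP]
          simp only [Matrix.mul_smul, Matrix.smul_mul]) u hu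
        have hc : (P m *ᵥ u) ⬝ᵥ (P m *ᵥ u) ≠ 0 := fun h => hne (dotProduct_self_eq_zero.mp h)
        have he : (P m * Matrix.vecMulVec x (P m *ᵥ u) * P m) *ᵥ u
            = ((P m *ᵥ u) ⬝ᵥ (P m *ᵥ u)) • (P m *ᵥ x) := by
          rw [← Matrix.mulVec_mulVec, ← Matrix.mulVec_mulVec, Matrix.vecMulVec_mulVec,
            op_smul_eq_smul, Matrix.mulVec_smul]
        rw [he] at key
        exact (Submodule.smul_mem_iff _ hc).mp key
      · rw [hx m hm]
        exact U.zero_mem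
  · rintro ⟨Ω, hΩ⟩ H hH x hx
    rw [hΩ] at hx ⊢
    intro m hm
    rw [hdecomp x, Matrix.mulVec_sum, Matrix.mulVec_sum]
    refine Finset.sum_eq_zero fun k _ => ?_
    by_cases hk : m = k
    · subst hk
      rw [hx m hm, Matrix.mulVec_zero, Matrix.mulVec_zero]
    · obtain ⟨l, hl⟩ : ∃ l, γ m l ≠ γ k l := by
        by_contra! h
        exact hk (hγ (funext h))
      have h1 : γ m l • (P m * H * P k) = γ k l • (P m * H * P k) := by
        calc γ m l • (P m * H * P k) = (P m * S l) * H * P k := by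
              rw [hPS]; simp only [Matrix.smul_mul]
          _ = P m * H * (S l * P k) := by
              rw [Matrix.mul_assoc (P m), ← hH l]; simp only [Matrix.mul_assoc]
          _ = _ := by rw [hSP, Matrix.mul_smul]
      have h2 : P m * H * P k = 0 := by
        rw [← sub_eq_zero, ← sub_smul] at h1
        exact (smul_eq_zero.mp h1).resolve_left (sub_ne_zero.mpr hl)
      rw [Matrix.mulVec_mulVec, Matrix.mulVec_mulVec, h2, Matrix.zero_mulVec]
end

section
/- Call a subspace U ⊆ ℝ^V bandlimited if there is a set Ω ⊆ {1,…,M} with U = { x ∈ ℝ^V : P_m x = 0 for all m ∉ Ω }. The following are equivalent for a subspace U ⊆ ℝ^V: (a) U is bandlimited; (b) U = { H x : x ∈ ℝ^V } (the range of x ↦ H x) for some polynomial filter H; (c) U = { x ∈ ℝ^V : G x = 0 } (the kernel of x ↦ G x) for some polynomial filter G. -/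
open Matrix

theorem stmt9
    {V : Type*} [Fintype V] [DecidableEq V] [Nonempty V]
    (hN : 2 ≤ Fintype.card V)
    {d M : ℕ} (hd : 1 ≤ d) (hM : 1 ≤ M)
    (S : Fin d → Matrix V V ℝ)
    (hSsym : ∀ l, (S l)ᵀ = S l)
    (hScomm : ∀ l l', S l * S l' = S l' * S l)
    (γ : Fin M → Fin d → ℝ) (hγ : Function.Injective γ)
    (P : Fin M → Matrix V V ℝ)
    (hPne : ∀ m, P m ≠ 0)
    (hPsym : ∀ m, (P m)ᵀ = P m)
    (hPidem : ∀ m, P m * P m = P m)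
    (hPorth : ∀ m m', m ≠ m' → P m * P m' = 0)
    (hPsum : ∑ m, P m = (1 : Matrix V V ℝ))
    (hSP : ∀ l m, S l * P m = γ m l • P m)
    (hPS : ∀ l m, P m * S l = γ m l • P m)
    (U : Submodule ℝ (V → ℝ)) :
    ((∃ Ω : Finset (Fin M), ∀ x : V → ℝ, x ∈ U ↔ ∀ m ∉ Ω, (P m) *ᵥ x = 0) ↔
      ∃ H ∈ Algebra.adjoin ℝ (Set.range S), U = LinearMap.range (Matrix.mulVecLin H))
    ∧ ((∃ Ω : Finset (Fin M), ∀ x : V → ℝ, x ∈ U ↔ ∀ m ∉ Ω, (P m) *ᵥ x = 0) ↔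
      ∃ G ∈ Algebra.adjoin ℝ (Set.range S), U = LinearMap.ker (Matrix.mulVecLin G)) := by
  classical
  have hQ : ∀ m, ∀ T : Finset (Fin M), m ∉ T → ∃ Q ∈ Algebra.adjoin ℝ (Set.range S),
      ∃ c : Fin M → ℝ, (∀ k, Q * P k = c k • P k) ∧ c m = 1 ∧ ∀ k ∈ T, c k = 0 := by
    intro m T
    induction T using Finset.induction_on with
    | empty =>
      intro _
      exact ⟨1, one_mem _, fun _ => 1, by simp, rfl, by simp⟩
    | insert a T ha ih =>
      intro hm
      rw [Finset.mem_insert, not_or] at hm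
      obtain ⟨Q, hQ, c, hc, hcm, hcT⟩ := ih hm.2
      have hne : γ m ≠ γ a := fun h => hm.1 (hγ h)
      obtain ⟨l, hl⟩ := Function.ne_iff.mp hne
      refine ⟨((γ m l - γ a l)⁻¹ • (S l - γ a l • 1)) * Q, mul_mem (Subalgebra.smul_mem _
        (sub_mem (Algebra.subset_adjoin (Set.mem_range_self l)) (Subalgebra.smul_mem _ (one_mem _) _)) _) hQ,
        fun k => (γ m l - γ a l)⁻¹ * (γ k l - γ a l) * c k, ?_, ?_, ?_⟩
      · intro k
        rw [mul_assoc, hc, mul_smul_comm, smul_mul_assoc, sub_mul, hSP, smul_mul_assoc, one_mul,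
          ← sub_smul, smul_smul, smul_smul]
        congr 1
        ring
      · simp only [hcm, mul_one]
        exact inv_mul_cancel₀ (sub_ne_zero.mpr hl)
      · intro k hk
        rcases Finset.mem_insert.mp hk with rfl | hk
        · simp
        · simp [hcT k hk]
  have hPmem : ∀ m, P m ∈ Algebra.adjoin ℝ (Set.range S) := by
    intro m
    obtain ⟨Q, hQ, c, hc, hcm, hcT⟩ := hQ m (Finset.univ.erase m) (by simp)
    have : Q = P m := by
      rw [← mul_one Q, ← hPsum, Finset.mul_sum, Finset.sum_eq_single m]
      · rw [hc, hcm, one_smul]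
      · intro k _ hk
        rw [hc, hcT k (by simp [hk]), zero_smul]
      · simp
    exact this ▸ hQ
  have hA : ∀ H ∈ Algebra.adjoin ℝ (Set.range S), ∃ c : Fin M → ℝ,
      ∀ k, H * P k = c k • P k ∧ P k * H = c k • P k := by
    intro H hH
    induction hH using Algebra.adjoin_induction with
    | mem x hx =>
      obtain ⟨l, rfl⟩ := hx
      exact ⟨fun k => γ k l, fun k => ⟨hSP l k, hPS l k⟩⟩
    | algebraMap r =>
      refine ⟨fun _ => r, fun k => ⟨?_, ?_⟩⟩
      · rw [Algebra.algebraMap_eq_smul_one, smul_mul_assoc, one_mul]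
      · rw [Algebra.algebraMap_eq_smul_one, mul_smul_comm, mul_one]
    | add x y _ _ hx hy =>
      obtain ⟨c, hc⟩ := hx
      obtain ⟨e, he⟩ := hy
      refine ⟨fun k => c k + e k, fun k => ⟨?_, ?_⟩⟩
      · rw [add_mul, (hc k).1, (he k).1, add_smul]
      · rw [mul_add, (hc k).2, (he k).2, add_smul]
    | mul x y _ _ hx hy =>
      obtain ⟨c, hc⟩ := hx
      obtain ⟨e, he⟩ := hy
      refine ⟨fun k => c k * e k, fun k => ⟨?_, ?_⟩⟩
      · rw [mul_assoc, (he k).1, mul_smul_comm, (hc k).1, smul_smul, mul_comm]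
      · rw [← mul_assoc, (hc k).2, smul_mul_assoc, (he k).2, smul_smul]
  have hB : ∀ c : Fin M → ℝ, ∃ H ∈ Algebra.adjoin ℝ (Set.range S),
      ∀ k, H * P k = c k • P k ∧ P k * H = c k • P k := by
    intro c
    refine ⟨∑ m, c m • P m, sum_mem fun m _ => Subalgebra.smul_mem _ (hPmem m) _,
      fun k => ⟨?_, ?_⟩⟩
    · rw [Finset.sum_mul, Finset.sum_eq_single k]
      · rw [smul_mul_assoc, hPidem]
      · intro b _ hb
        rw [smul_mul_assoc, hPorth b k hb, smul_zero]
      · simp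
    · rw [Finset.mul_sum, Finset.sum_eq_single k]
      · rw [mul_smul_comm, hPidem]
      · intro b _ hb
        rw [mul_smul_comm, hPorth k b hb.symm, smul_zero]
      · simp
  have hdec : ∀ x : V → ℝ, ∑ m, P m *ᵥ x = x := by
    intro x
    rw [← Matrix.sum_mulVec, hPsum, Matrix.one_mulVec]
  have hker : ∀ (H : Matrix V V ℝ) (c : Fin M → ℝ),
      (∀ k, H * P k = c k • P k ∧ P k * H = c k • P k) →
      ∀ x, x ∈ LinearMap.ker (Matrix.mulVecLin H) ↔ ∀ m, c m ≠ 0 → P m *ᵥ x = 0 := by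
    intro H c hc x
    have key : ∀ m, P m *ᵥ (H *ᵥ x) = c m • (P m *ᵥ x) := by
      intro m
      rw [Matrix.mulVec_mulVec, (hc m).2, Matrix.smul_mulVec]
    rw [LinearMap.mem_ker, Matrix.mulVecLin_apply]
    constructor
    · intro h m hm
      have := key m
      rw [h, Matrix.mulVec_zero] at this
      exact (smul_eq_zero.mp this.symm).resolve_left hm
    · intro h
      rw [← hdec (H *ᵥ x)]
      refine Finset.sum_eq_zero fun m _ => ?_
      rw [key]
      by_cases hm : c m = 0
      · rw [hm, zero_smul]
      · rw [h m hm, smul_zero]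
  have hrange : ∀ (H : Matrix V V ℝ) (c : Fin M → ℝ),
      (∀ k, H * P k = c k • P k ∧ P k * H = c k • P k) →
      ∀ x, x ∈ LinearMap.range (Matrix.mulVecLin H) ↔ ∀ m, c m = 0 → P m *ᵥ x = 0 := by
    intro H c hc x
    constructor
    · rintro ⟨y, rfl⟩ m hm
      rw [Matrix.mulVecLin_apply, Matrix.mulVec_mulVec, (hc m).2, hm, zero_smul,
        Matrix.zero_mulVec]
    · intro h
      refine ⟨∑ m, (c m)⁻¹ • (P m *ᵥ x), ?_⟩
      rw [map_sum]
      conv_rhs => rw [← hdec x]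
      refine Finset.sum_congr rfl fun m _ => ?_
      rw [map_smul, Matrix.mulVecLin_apply, Matrix.mulVec_mulVec, (hc m).1, Matrix.smul_mulVec,
        smul_smul]
      by_cases hm : c m = 0
      · rw [h m hm, smul_zero]
      · rw [inv_mul_cancel₀ hm, one_smul]
  refine ⟨⟨?_, ?_⟩, ⟨?_, ?_⟩⟩
  · rintro ⟨Ω, hΩ⟩
    obtain ⟨H, hH, hc⟩ := hB (fun m => if m ∈ Ω then 1 else 0)
    refine ⟨H, hH, ?_⟩
    ext x
    rw [hΩ, hrange H _ hc]
    simp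
  · rintro ⟨H, hH, rfl⟩
    obtain ⟨c, hc⟩ := hA H hH
    refine ⟨Finset.univ.filter fun m => c m ≠ 0, fun x => ?_⟩
    rw [hrange H c hc]
    simp
  · rintro ⟨Ω, hΩ⟩
    obtain ⟨H, hH, hc⟩ := hB (fun m => if m ∈ Ω then 0 else 1)
    refine ⟨H, hH, ?_⟩
    ext x
    rw [hΩ, hker H _ hc]
    simp
  · rintro ⟨H, hH, rfl⟩
    obtain ⟨c, hc⟩ := hA H hH
    refine ⟨Finset.univ.filter fun m => c m = 0, fun x => ?_⟩
    rw [hker H c hc]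
    simp
end

section
/- Let U ⊆ ℝ^V be a shift-invariant subspace. The following are equivalent: (i) S_l U = U (the image of U under x ↦ S_l x equals U) for every 1 ≤ l ≤ d; (ii) (S_1 S_2 ⋯ S_d) U = U, i.e., the image of U under x ↦ (S_1 S_2 ⋯ S_d) x equals U; (iii) U ∩ W_m = {0} for every 1 ≤ m ≤ M such that γ_1(m) γ_2(m) ⋯ γ_d(m) = 0. -/
open Matrix

theorem map_eq_iff_aux {E : Type*} [AddCommGroup E] [Module ℝ E] [FiniteDimensional ℝ E]
    (U : Submodule ℝ E) (f : E →ₗ[ℝ] E) (hf : ∀ x ∈ U, f x ∈ U) :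
    U.map f = U ↔ ∀ x ∈ U, f x = 0 → x = 0 := by
  have key : Function.Injective (f.restrict hf) ↔ Function.Surjective (f.restrict hf) :=
    LinearMap.injective_iff_surjective
  constructor
  · intro h x hx h0
    have hs : Function.Surjective (f.restrict hf) := by
      rintro ⟨y, hy⟩
      rw [← h] at hy
      obtain ⟨z, hz, hzy⟩ := hy
      exact ⟨⟨z, hz⟩, Subtype.ext hzy⟩
    have hi := key.2 hs
    have : (⟨x, hx⟩ : U) = 0 := by
      apply hi
      apply Subtype.ext
      simpa using h0
    simpa using congrArg Subtype.val this
  · intro h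
    have hi : Function.Injective (f.restrict hf) := by
      rw [injective_iff_map_eq_zero]
      rintro ⟨x, hx⟩ h0
      apply Subtype.ext
      exact h x hx (by simpa using congrArg Subtype.val h0)
    have hs := key.1 hi
    apply le_antisymm
    · rintro _ ⟨x, hx, rfl⟩
      exact hf x hx
    · intro y hy
      obtain ⟨z, hz⟩ := hs ⟨y, hy⟩
      exact ⟨z.1, z.2, congrArg Subtype.val hz⟩

theorem prod_act_aux {V : Type*} [Fintype V] [DecidableEq V] {d : ℕ}
    (S : Fin d → Matrix V V ℝ) (g : Fin d → ℝ) (P : Matrix V V ℝ)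
    (h : ∀ l, S l * P = g l • P) (L : List (Fin d)) :
    (L.map S).prod * P = (L.map g).prod • P := by
  induction L with
  | nil => simp
  | cons a L ih =>
    simp only [List.map_cons, List.prod_cons]
    rw [Matrix.mul_assoc, ih, Matrix.mul_smul, h, smul_smul, mul_comm]

theorem prod_mem_aux {V : Type*} [Fintype V] [DecidableEq V] {d : ℕ}
    (S : Fin d → Matrix V V ℝ) (U : Submodule ℝ (V → ℝ))
    (hU : ∀ l : Fin d, ∀ x ∈ U, (S l) *ᵥ x ∈ U) (L : List (Fin d)) :
    ∀ x ∈ U, (L.map S).prod *ᵥ x ∈ U := by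
  induction L with
  | nil => simp
  | cons a L ih =>
    intro x hx
    simp only [List.map_cons, List.prod_cons]
    rw [← Matrix.mulVec_mulVec]
    exact hU _ _ (ih x hx)

theorem prod_inj_aux {V : Type*} [Fintype V] [DecidableEq V] {d : ℕ}
    (S : Fin d → Matrix V V ℝ) (U : Submodule ℝ (V → ℝ))
    (hU : ∀ l : Fin d, ∀ x ∈ U, (S l) *ᵥ x ∈ U)
    (hi : ∀ l : Fin d, ∀ x ∈ U, (S l) *ᵥ x = 0 → x = 0) (L : List (Fin d)) :
    ∀ x ∈ U, (L.map S).prod *ᵥ x = 0 → x = 0 := by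
  induction L with
  | nil => simp
  | cons a L ih =>
    intro x hx
    simp only [List.map_cons, List.prod_cons]
    rw [← Matrix.mulVec_mulVec]
    intro h
    exact ih x hx (hi a _ (prod_mem_aux S U hU L x hx) h)

theorem stmt10
    {V : Type*} [Fintype V] [DecidableEq V] [Nonempty V]
    (hN : 2 ≤ Fintype.card V)
    {d M : ℕ} (hd : 1 ≤ d) (hM : 1 ≤ M)
    (S : Fin d → Matrix V V ℝ)
    (hSsym : ∀ l, (S l)ᵀ = S l)
    (hScomm : ∀ l l', S l * S l' = S l' * S l)
    (γ : Fin M → Fin d → ℝ) (hγ : Function.Injective γ)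
    (P : Fin M → Matrix V V ℝ)
    (hPne : ∀ m, P m ≠ 0)
    (hPsym : ∀ m, (P m)ᵀ = P m)
    (hPidem : ∀ m, P m * P m = P m)
    (hPorth : ∀ m m', m ≠ m' → P m * P m' = 0)
    (hPsum : ∑ m, P m = (1 : Matrix V V ℝ))
    (hSP : ∀ l m, S l * P m = γ m l • P m)
    (hPS : ∀ l m, P m * S l = γ m l • P m)
    (U : Submodule ℝ (V → ℝ))
    (hU : ∀ l : Fin d, ∀ x ∈ U, (S l) *ᵥ x ∈ U) :
    ((∀ l, U.map (S l).mulVecLin = U) ↔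
        U.map ((List.ofFn S).prod).mulVecLin = U)
    ∧ ((∀ l, U.map (S l).mulVecLin = U) ↔
        ∀ m, (∏ l, γ m l) = 0 →
          U ⊓ LinearMap.range (P m).mulVecLin = ⊥) := by
  have hSPv : ∀ l m x, P m *ᵥ (S l *ᵥ x) = γ m l • (P m *ᵥ x) := by
    intro l m x
    rw [Matrix.mulVec_mulVec, hPS, Matrix.smul_mulVec]
  have hsumv : ∀ x : V → ℝ, ∑ m, P m *ᵥ x = x := by
    intro x
    rw [← Matrix.sum_mulVec, hPsum, Matrix.one_mulVec]
  have hA : List.ofFn S = (List.finRange d).map S := List.ofFn_eq_map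
  have e1 : (∀ l, U.map (S l).mulVecLin = U) ↔ ∀ l : Fin d, ∀ x ∈ U, (S l) *ᵥ x = 0 → x = 0 :=
    forall_congr' fun l => map_eq_iff_aux U (S l).mulVecLin (hU l)
  have e2 : U.map ((List.ofFn S).prod).mulVecLin = U ↔
      ∀ x ∈ U, (List.ofFn S).prod *ᵥ x = 0 → x = 0 :=
    map_eq_iff_aux U ((List.ofFn S).prod).mulVecLin (by
      rw [hA]
      exact prod_mem_aux S U hU _)
  have h12 : (∀ l : Fin d, ∀ x ∈ U, (S l) *ᵥ x = 0 → x = 0) →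
      ∀ x ∈ U, (List.ofFn S).prod *ᵥ x = 0 → x = 0 := by
    intro h
    rw [hA]
    exact prod_inj_aux S U hU h _
  have h23 : (∀ x ∈ U, (List.ofFn S).prod *ᵥ x = 0 → x = 0) →
      ∀ m, (∏ l, γ m l) = 0 → U ⊓ LinearMap.range (P m).mulVecLin = ⊥ := by
    intro h m hm
    rw [eq_bot_iff]
    rintro x ⟨hx, y, rfl⟩
    rw [Submodule.mem_bot]
    apply h _ hx
    rw [Matrix.mulVecLin_apply, Matrix.mulVec_mulVec, hA,
      prod_act_aux S (γ m) (P m) (fun l => hSP l m), ← List.ofFn_eq_map, List.prod_ofFn, hm]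
    simp
  have h31 : (∀ m, (∏ l, γ m l) = 0 → U ⊓ LinearMap.range (P m).mulVecLin = ⊥) →
      ∀ l : Fin d, ∀ x ∈ U, (S l) *ᵥ x = 0 → x = 0 := by
    intro h l
    have main : ∀ n : ℕ, ∀ x ∈ U, (S l) *ᵥ x = 0 →
        (Finset.univ.filter fun m => P m *ᵥ x ≠ 0).card ≤ n → x = 0 := by
      intro n
      induction n with
      | zero =>
        intro x hx h0 hc
        have hc' := Finset.card_eq_zero.1 (Nat.le_zero.1 hc)
        rw [← hsumv x]
        apply Finset.sum_eq_zero
        intro m _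
        by_contra hne
        have : m ∈ (Finset.univ.filter fun m => P m *ᵥ x ≠ 0) := by simp [hne]
        rw [hc'] at this
        simp at this
      | succ n ih =>
        intro x hx h0 hc
        by_contra hx0
        obtain ⟨m, hm⟩ : ∃ m, P m *ᵥ x ≠ 0 := by
          by_contra hcon
          push Not at hcon
          apply hx0
          rw [← hsumv x]
          exact Finset.sum_eq_zero fun m _ => hcon m
        have hother : ∀ m', m' ≠ m → P m' *ᵥ x = 0 := by
          intro m' hne
          obtain ⟨l', hl'⟩ := Function.ne_iff.1 (hγ.ne hne)
          have hPz : ∀ k, P k *ᵥ (S l' *ᵥ x - γ m l' • x) = (γ k l' - γ m l') • (P k *ᵥ x) := by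
            intro k
            rw [Matrix.mulVec_sub, hSPv, Matrix.mulVec_smul, sub_smul]
          have hz : S l' *ᵥ x - γ m l' • x = 0 := by
            apply ih
            · exact U.sub_mem (hU _ _ hx) (U.smul_mem _ hx)
            · rw [Matrix.mulVec_sub, Matrix.mulVec_smul, h0, Matrix.mulVec_mulVec, hScomm,
                ← Matrix.mulVec_mulVec, h0]
              simp
            · apply Nat.le_of_lt_succ
              refine lt_of_lt_of_le (Finset.card_lt_card ?_) hc
              rw [Finset.ssubset_iff_of_subset]
              · refine ⟨m, by simpa using hm, ?_⟩
                simp [hPz]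
              · intro k
                simp only [Finset.mem_filter, Finset.mem_univ, true_and, hPz]
                intro hk hk0
                apply hk
                rw [hk0, smul_zero]
          have hz' := hPz m'
          rw [hz, Matrix.mulVec_zero] at hz'
          exact (smul_eq_zero.1 hz'.symm).resolve_left (sub_ne_zero.2 hl')
        have hPx : P m *ᵥ x = x := by
          conv_rhs => rw [← hsumv x]
          symm
          exact Finset.sum_eq_single m (fun k _ hk => hother k hk) (by simp)
        have hg : γ m l = 0 := by
          have := hSPv l m x
          rw [h0, Matrix.mulVec_zero] at this
          exact (smul_eq_zero.1 this.symm).resolve_right hm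
        have hb := h m (Finset.prod_eq_zero (Finset.mem_univ l) hg)
        have hmem : x ∈ U ⊓ LinearMap.range (P m).mulVecLin := ⟨hx, x, hPx⟩
        rw [hb, Submodule.mem_bot] at hmem
        exact hx0 hmem
    intro x hx h0
    exact main _ x hx h0 le_rfl
  rw [e1, e2]
  exact ⟨⟨h12, fun h => h31 (h23 h)⟩, ⟨fun h => h23 (h12 h), h31⟩⟩
end

section
/- Let U ⊆ ℝ^V be a shift-invariant subspace and let U_M = (S_1 S_2 ⋯ S_d) U be the image of U under the linear map x ↦ (S_1 S_2 ⋯ S_d) x. Then S_l U_M = U_M for every 1 ≤ l ≤ d, and U_M is the maximal such subspace of U: every subspace W ⊆ U satisfying S_l W = W for all 1 ≤ l ≤ d is contained in U_M. -/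
open Matrix

lemma aux_factor {R : Type*} [Monoid R] (B : R) (L : List R)
    (hc : ∀ A ∈ L, B * A = A * B) (hB : B ∈ L) : ∃ Q, L.prod = B * Q := by
  induction L with
  | nil => simp at hB
  | cons A L ih =>
    rcases List.mem_cons.1 hB with h | h
    · exact ⟨L.prod, by rw [List.prod_cons, h]⟩
    · obtain ⟨Q, hQ⟩ := ih (fun A hA => hc A (List.mem_cons_of_mem _ hA)) h
      refine ⟨A * Q, ?_⟩
      rw [List.prod_cons, hQ, ← mul_assoc, ← mul_assoc, hc A List.mem_cons_self]

lemma aux_map {V : Type*} [Fintype V] [DecidableEq V] (W : Submodule ℝ (V → ℝ))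
    (L : List (Matrix V V ℝ)) (h : ∀ A ∈ L, W.map A.mulVecLin = W) :
    W.map L.prod.mulVecLin = W := by
  induction L with
  | nil => simp
  | cons A L ih =>
    rw [List.prod_cons, Matrix.mulVecLin_mul, Submodule.map_comp,
      ih (fun A hA => h A (List.mem_cons_of_mem _ hA)), h A List.mem_cons_self]

theorem stmt11
    {V : Type*} [Fintype V] [DecidableEq V] [Nonempty V]
    (hN : 2 ≤ Fintype.card V)
    {d M : ℕ} (hd : 1 ≤ d) (hM : 1 ≤ M)
    (S : Fin d → Matrix V V ℝ)
    (hSsym : ∀ l, (S l)ᵀ = S l)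
    (hScomm : ∀ l l', S l * S l' = S l' * S l)
    (γ : Fin M → Fin d → ℝ) (hγ : Function.Injective γ)
    (P : Fin M → Matrix V V ℝ)
    (hPne : ∀ m, P m ≠ 0)
    (hPsym : ∀ m, (P m)ᵀ = P m)
    (hPidem : ∀ m, P m * P m = P m)
    (hPorth : ∀ m m', m ≠ m' → P m * P m' = 0)
    (hPsum : ∑ m, P m = (1 : Matrix V V ℝ))
    (hSP : ∀ l m, S l * P m = γ m l • P m)
    (hPS : ∀ l m, P m * S l = γ m l • P m)
    (U : Submodule ℝ (V → ℝ))
    (hU : ∀ l : Fin d, ∀ x ∈ U, (S l) *ᵥ x ∈ U) :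
    (∀ l, (U.map ((List.ofFn S).prod).mulVecLin).map (S l).mulVecLin
        = U.map ((List.ofFn S).prod).mulVecLin)
    ∧ ∀ W : Submodule ℝ (V → ℝ), W ≤ U →
        (∀ l, W.map (S l).mulVecLin = W) →
        W ≤ U.map ((List.ofFn S).prod).mulVecLin := by
  constructor
  · intro l
    have hmem : S l ∈ List.ofFn S := by simp [List.mem_ofFn]
    have hc : ∀ A ∈ List.ofFn S, S l * A = A * S l := by
      intro A hA
      obtain ⟨k, rfl⟩ := (List.mem_ofFn' _ _).1 hA
      exact hScomm _ _
    have hcT : S l * (List.ofFn S).prod = (List.ofFn S).prod * S l :=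
      Commute.list_prod_right _ _ hc
    obtain ⟨Q, hQ⟩ := aux_factor (S l) _ hc hmem
    set T := (List.ofFn S).prod with hT
    have hmaps : ∀ x ∈ U.map T.mulVecLin, (S l).mulVecLin x ∈ U.map T.mulVecLin := by
      rintro _ ⟨u, hu, rfl⟩
      refine ⟨S l *ᵥ u, hU l u hu, ?_⟩
      simp [Matrix.mulVec_mulVec, hcT]
    have hinj : Function.Injective ((S l).mulVecLin.restrict hmaps) := by
      rw [← LinearMap.ker_eq_bot, LinearMap.ker_eq_bot']
      rintro ⟨_, u, hu, rfl⟩ h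
      have h1 : S l *ᵥ (T *ᵥ u) = 0 := congrArg Subtype.val h
      apply Subtype.ext
      change T *ᵥ u = 0
      rw [hQ, ← Matrix.mulVec_mulVec] at h1 ⊢
      have h2 : Q *ᵥ u ∈ LinearMap.ker ((S l)ᵀ * S l).mulVecLin := by
        rw [LinearMap.mem_ker, Matrix.mulVecLin_apply, hSsym, ← Matrix.mulVec_mulVec, h1]
      rw [Matrix.ker_mulVecLin_transpose_mul_self] at h2
      exact h2
    have hsurj := LinearMap.injective_iff_surjective.1 hinj
    apply le_antisymm
    · rintro _ ⟨x, hx, rfl⟩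
      exact hmaps x hx
    · intro x hx
      obtain ⟨y, hy⟩ := hsurj ⟨x, hx⟩
      exact ⟨y.1, y.2, congrArg Subtype.val hy⟩
  · intro W hW h
    have h1 : W.map (List.ofFn S).prod.mulVecLin = W := by
      apply aux_map
      intro A hA
      obtain ⟨k, rfl⟩ := (List.mem_ofFn' _ _).1 hA
      exact h k
    calc W = W.map (List.ofFn S).prod.mulVecLin := h1.symm
      _ ≤ _ := Submodule.map_mono hW
end

section
/- Let φ_1, …, φ_r ∈ ℝ^V be graph signals. Then for every 1 ≤ m ≤ M, S(φ_1,…,φ_r) ∩ W_m = span_ℝ{ P_m φ_1, …, P_m φ_r }; that is, the graph range function of the finitely generated shift-invariant space S(φ_1,…,φ_r) at frequency γ(m) equals the span of the fibers P_m φ_i of its generators. -/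
open Matrix

/-- The multi-shift `S^α = S_1^{α_1} ⋯ S_d^{α_d}`. -/
noncomputable def Spow {V : Type*} [Fintype V] [DecidableEq V] {d : ℕ}
    (S : Fin d → Matrix V V ℝ) (α : Fin d → ℕ) : Matrix V V ℝ :=
  (List.ofFn fun l => S l ^ α l).prod

/-- The shift-invariant space generated by the graph signals `φ 1, …, φ r`:
the span of all shifts `S^α (φ i)`, `α ∈ ℕ^d`. -/
noncomputable def gsisSpan {V : Type*} [Fintype V] [DecidableEq V] {d r : ℕ}
    (S : Fin d → Matrix V V ℝ) (φ : Fin r → V → ℝ) : Submodule ℝ (V → ℝ) :=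
  Submodule.span ℝ { y | ∃ α : Fin d → ℕ, ∃ i : Fin r, y = (Spow S α) *ᵥ φ i }

theorem pow_mul_P {V : Type*} [Fintype V] [DecidableEq V] (A Q : Matrix V V ℝ) (c : ℝ)
    (h : A * Q = c • Q) (n : ℕ) : A ^ n * Q = c ^ n • Q := by
  induction n with
  | zero => simp
  | succ n ih => rw [pow_succ, mul_assoc, h, mul_smul_comm, ih, smul_smul, pow_succ, mul_comm]

theorem P_mul_pow {V : Type*} [Fintype V] [DecidableEq V] (A Q : Matrix V V ℝ) (c : ℝ)
    (h : Q * A = c • Q) (n : ℕ) : Q * A ^ n = c ^ n • Q := by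
  induction n with
  | zero => simp
  | succ n ih => rw [pow_succ, ← mul_assoc, ih, smul_mul_assoc, h, smul_smul, pow_succ]

theorem Spow_mul_P {V : Type*} [Fintype V] [DecidableEq V] {d : ℕ}
    (S : Fin d → Matrix V V ℝ) (α : Fin d → ℕ) (Q : Matrix V V ℝ) (g : Fin d → ℝ)
    (h : ∀ l, S l * Q = g l • Q) : Spow S α * Q = (∏ l, g l ^ α l) • Q := by
  unfold Spow
  induction d with
  | zero => simp
  | succ d ih =>
    rw [List.ofFn_succ, List.prod_cons, Fin.prod_univ_succ, mul_assoc,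
      ih (fun l => S l.succ) (fun l => α l.succ) (fun l => g l.succ) (fun l => h l.succ),
      mul_smul_comm, pow_mul_P _ _ _ (h 0), smul_smul, mul_comm]

theorem P_mul_Spow {V : Type*} [Fintype V] [DecidableEq V] {d : ℕ}
    (S : Fin d → Matrix V V ℝ) (α : Fin d → ℕ) (Q : Matrix V V ℝ) (g : Fin d → ℝ)
    (h : ∀ l, Q * S l = g l • Q) : Q * Spow S α = (∏ l, g l ^ α l) • Q := by
  unfold Spow
  induction d with
  | zero => simp
  | succ d ih =>
    rw [List.ofFn_succ, List.prod_cons, Fin.prod_univ_succ, ← mul_assoc,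
      P_mul_pow _ _ _ (h 0), smul_mul_assoc,
      ih (fun l => S l.succ) (fun l => α l.succ) (fun l => g l.succ) (fun l => h l.succ),
      smul_smul]

theorem stmt12
    {V : Type*} [Fintype V] [DecidableEq V] [Nonempty V]
    (hN : 2 ≤ Fintype.card V)
    {d M : ℕ} (hd : 1 ≤ d) (hM : 1 ≤ M)
    (S : Fin d → Matrix V V ℝ)
    (hSsym : ∀ l, (S l)ᵀ = S l)
    (hScomm : ∀ l l', S l * S l' = S l' * S l)
    (γ : Fin M → Fin d → ℝ) (hγ : Function.Injective γ)
    (P : Fin M → Matrix V V ℝ)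
    (hPne : ∀ m, P m ≠ 0)
    (hPsym : ∀ m, (P m)ᵀ = P m)
    (hPidem : ∀ m, P m * P m = P m)
    (hPorth : ∀ m m', m ≠ m' → P m * P m' = 0)
    (hPsum : ∑ m, P m = (1 : Matrix V V ℝ))
    (hSP : ∀ l m, S l * P m = γ m l • P m)
    (hPS : ∀ l m, P m * S l = γ m l • P m)
    (r : ℕ) (φ : Fin r → V → ℝ) :
    ∀ m, gsisSpan S φ ⊓ LinearMap.range (P m).mulVecLin
      = Submodule.span ℝ (Set.range fun i : Fin r => (P m) *ᵥ φ i) := by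
  intro m
  have ext_P : ∀ A B : Matrix V V ℝ, (∀ k, A * P k = B * P k) → A = B := by
    intro A B h
    rw [← mul_one A, ← mul_one B, ← hPsum, Finset.mul_sum, Finset.mul_sum]
    exact Finset.sum_congr rfl fun k _ => h k
  have hstep : ∀ l α, S l * Spow S α = Spow S (α + Pi.single l 1) := by
    intro l α
    apply ext_P
    intro k
    rw [mul_assoc, Spow_mul_P S α (P k) (γ k) (fun l => hSP l k),
      Spow_mul_P S _ (P k) (γ k) (fun l => hSP l k), mul_smul_comm, hSP, smul_smul]
    congr 1
    simp only [Pi.add_apply, pow_add, Finset.prod_mul_distrib]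
    congr 1
    simp [Pi.single_apply, pow_ite]
  have hinv : ∀ l, ∀ x ∈ gsisSpan S φ, S l *ᵥ x ∈ gsisSpan S φ := by
    intro l x hx
    unfold gsisSpan at hx
    induction hx using Submodule.span_induction with
    | mem x hx =>
      obtain ⟨α, i, rfl⟩ := hx
      rw [Matrix.mulVec_mulVec, hstep]
      exact Submodule.subset_span ⟨_, i, rfl⟩
    | zero => simp
    | add x y _ _ hx hy => rw [Matrix.mulVec_add]; exact add_mem hx hy
    | smul a x _ hx => rw [Matrix.mulVec_smul]; exact Submodule.smul_mem _ _ hx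
  have hA : ∀ s : Finset (Fin M), m ∉ s → ∃ A : Matrix V V ℝ,
      (∀ x ∈ gsisSpan S φ, A *ᵥ x ∈ gsisSpan S φ) ∧ A * P m = P m ∧
      ∀ k ∈ s, A * P k = 0 := by
    intro s
    induction s using Finset.induction_on with
    | empty => intro _; exact ⟨1, by simp, by simp, by simp⟩
    | insert j s hj ih =>
      intro hm
      simp only [Finset.mem_insert, not_or] at hm
      obtain ⟨A, h1, h2, h3⟩ := ih hm.2
      obtain ⟨l, hl⟩ : ∃ l, γ m l ≠ γ j l := by
        by_contra! hc
        exact hm.1 (hγ (funext hc))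
      have hl' : γ m l - γ j l ≠ 0 := sub_ne_zero.mpr hl
      refine ⟨A * ((γ m l - γ j l)⁻¹ • (S l - γ j l • 1)), ?_, ?_, ?_⟩
      · intro x hx
        rw [← Matrix.mulVec_mulVec]
        apply h1
        rw [Matrix.smul_mulVec, Matrix.sub_mulVec, Matrix.smul_mulVec, Matrix.one_mulVec]
        exact Submodule.smul_mem _ _ (sub_mem (hinv l x hx) (Submodule.smul_mem _ _ hx))
      · rw [mul_assoc, smul_mul_assoc, sub_mul, hSP, smul_mul_assoc, one_mul, ← sub_smul,
          smul_smul, inv_mul_cancel₀ hl', one_smul, h2]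
      · intro k hk
        rw [mul_assoc, smul_mul_assoc, sub_mul, hSP, smul_mul_assoc, one_mul, ← sub_smul]
        rcases Finset.mem_insert.mp hk with rfl | hk
        · simp
        · simp [h3 k hk]
  have hPinv : ∀ x ∈ gsisSpan S φ, P m *ᵥ x ∈ gsisSpan S φ := by
    obtain ⟨A, h1, h2, h3⟩ := hA (Finset.univ.erase m) (by simp)
    have : A = P m := by
      apply ext_P
      intro k
      by_cases hk : k = m
      · subst hk; rw [h2, hPidem]
      · rw [h3 k (by simp [hk]), hPorth m k (Ne.symm hk)]
    rwa [this] at h1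
  apply le_antisymm
  · rintro x ⟨hx, y, rfl⟩
    have hfix : P m *ᵥ ((P m).mulVecLin y) = (P m).mulVecLin y := by
      simp [Matrix.mulVec_mulVec, hPidem]
    rw [← hfix]
    have key : ∀ x ∈ gsisSpan S φ,
        P m *ᵥ x ∈ Submodule.span ℝ (Set.range fun i : Fin r => (P m) *ᵥ φ i) := by
      intro x hx
      unfold gsisSpan at hx
      induction hx using Submodule.span_induction with
      | mem x hx =>
        obtain ⟨α, i, rfl⟩ := hx
        rw [Matrix.mulVec_mulVec, P_mul_Spow S α (P m) (γ m) (fun l => hPS l m),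
          Matrix.smul_mulVec]
        exact Submodule.smul_mem _ _ (Submodule.subset_span ⟨i, rfl⟩)
      | zero => simp
      | add x y _ _ hx hy => rw [Matrix.mulVec_add]; exact add_mem hx hy
      | smul a x _ hx => rw [Matrix.mulVec_smul]; exact Submodule.smul_mem _ _ hx
    exact key _ hx
  · rw [Submodule.span_le]
    rintro _ ⟨i, rfl⟩
    refine ⟨hPinv _ (Submodule.subset_span ⟨0, i, ?_⟩), φ i, rfl⟩
    simp [Spow]
end

section
/- Let a ∈ ℝ^d be such that the numbers μ(m) = Σ_{l=1}^d a_l γ_l(m), 1 ≤ m ≤ M, are pairwise distinct, and set T = Σ_{l=1}^d a_l S_l. For a subspace U ⊆ ℝ^V the following are equivalent: (i) U is shift-invariant; (ii) there exist r ≥ 1 and graph signals φ_1, …, φ_r ∈ ℝ^V with U = S(φ_1,…,φ_r) (every GSIS is finitely generated); (iii) there exist r ≥ 1 and graph signals φ_1, …, φ_r ∈ ℝ^V with U = span_ℝ{ T^k φ_i : 0 ≤ k ≤ M−1, 1 ≤ i ≤ r }. -/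
open Matrix

theorem Spow_zero_aux {V : Type*} [Fintype V] [DecidableEq V] {d : ℕ}
    (S : Fin d → Matrix V V ℝ) : Spow S (fun _ => 0) = 1 := by
  unfold Spow
  apply List.prod_eq_one
  intro x hx
  rw [List.mem_ofFn] at hx
  obtain ⟨i, rfl⟩ := hx
  simp

theorem mul_Spow_aux {V : Type*} [Fintype V] [DecidableEq V] : ∀ {d : ℕ}
    (S : Fin d → Matrix V V ℝ) (_ : ∀ l l', S l * S l' = S l' * S l)
    (α : Fin d → ℕ) (l : Fin d), ∃ β : Fin d → ℕ, S l * Spow S α = Spow S β := by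
  intro d
  induction d with
  | zero => intro S _ α l; exact l.elim0
  | succ d ih =>
    intro S hS α l
    have key : ∀ β : Fin (d+1) → ℕ,
        Spow S β = S 0 ^ β 0 * Spow (fun i => S i.succ) (fun i => β i.succ) := by
      intro β
      simp [Spow, List.ofFn_succ]
    refine Fin.cases ?_ (fun j => ?_) l
    · refine ⟨Fin.cons (α 0 + 1) (fun i => α i.succ), ?_⟩
      rw [key, key]
      simp [pow_succ', mul_assoc]
    · obtain ⟨β, hβ⟩ := ih (fun i => S i.succ) (fun _ _ => hS _ _) (fun i => α i.succ) j
      refine ⟨Fin.cons (α 0) β, ?_⟩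
      rw [key, key]
      have hc : Commute (S j.succ) (S 0 ^ α 0) := Commute.pow_right (hS _ _) _
      simp only [Fin.cons_zero, Fin.cons_succ]
      rw [← mul_assoc, hc.eq, mul_assoc]
      exact congrArg _ hβ

theorem Spow_mem_aux {V : Type*} [Fintype V] [DecidableEq V] : ∀ {d : ℕ}
    (S : Fin d → Matrix V V ℝ) (U : Submodule ℝ (V → ℝ))
    (_ : ∀ l : Fin d, ∀ x ∈ U, (S l) *ᵥ x ∈ U)
    (α : Fin d → ℕ), ∀ x ∈ U, Spow S α *ᵥ x ∈ U := by
  intro d S U hU α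
  unfold Spow
  have hp : ∀ (A : Matrix V V ℝ), (∀ x ∈ U, A *ᵥ x ∈ U) → ∀ k : ℕ, ∀ x ∈ U, (A ^ k) *ᵥ x ∈ U := by
    intro A hA k
    induction k with
    | zero => simp
    | succ k ih =>
      intro x hx
      rw [pow_succ', ← Matrix.mulVec_mulVec]
      exact hA _ (ih x hx)
  have hl : ∀ L : List (Matrix V V ℝ), (∀ A ∈ L, ∀ x ∈ U, A *ᵥ x ∈ U) →
      ∀ x ∈ U, L.prod *ᵥ x ∈ U := by
    intro L
    induction L with
    | nil => simp
    | cons A L ih =>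
      intro h x hx
      rw [List.prod_cons, ← Matrix.mulVec_mulVec]
      exact h A (by simp) _ (ih (fun B hB => h B (by simp [hB])) x hx)
  apply hl
  intro A hA
  rw [List.mem_ofFn] at hA
  obtain ⟨i, rfl⟩ := hA
  exact hp _ (hU i) _

theorem exists_gen_aux {V : Type*} [Fintype V] (U : Submodule ℝ (V → ℝ)) :
    ∃ r : ℕ, 1 ≤ r ∧ ∃ φ : Fin r → V → ℝ, Submodule.span ℝ (Set.range φ) = U := by
  obtain ⟨n, s, hs⟩ := Submodule.fg_iff_exists_fin_generating_family.1
    (IsNoetherian.noetherian U)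
  refine ⟨n + 1, by omega, Fin.cons 0 s, ?_⟩
  rw [Fin.range_cons, Submodule.span_insert_zero, hs]

theorem interp_aux {V : Type*} [Fintype V] [DecidableEq V] {M : ℕ} (hM : 1 ≤ M)
    (P : Fin M → Matrix V V ℝ) (hPsum : ∑ m, P m = (1 : Matrix V V ℝ))
    (T : Matrix V V ℝ) (μ c : Fin M → ℝ) (hμ : Function.Injective μ)
    (hT : ∀ m, T * P m = μ m • P m) (A : Matrix V V ℝ) (hA : ∀ m, A * P m = c m • P m) :
    ∃ b : ℕ → ℝ, A = ∑ k ∈ Finset.range M, b k • T ^ k := by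
  have hTk : ∀ k m, T ^ k * P m = μ m ^ k • P m := by
    intro k m
    induction k with
    | zero => simp
    | succ k ih => rw [pow_succ, mul_assoc, hT, Matrix.mul_smul, ih, smul_smul, pow_succ']
  let p := Lagrange.interpolate Finset.univ μ c
  have hdeg : p.natDegree < M := by
    have h := Lagrange.degree_interpolate_lt (s := Finset.univ) (v := μ) c (hμ.injOn)
    rw [Finset.card_univ, Fintype.card_fin] at h
    by_cases h0 : p = 0
    · rw [h0, Polynomial.natDegree_zero]; exact hM
    · exact (Polynomial.natDegree_lt_iff_degree_lt h0).2 h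
  refine ⟨p.coeff, ?_⟩
  rw [← mul_one A, ← mul_one (∑ k ∈ Finset.range M, _), ← hPsum, Finset.mul_sum, Finset.mul_sum]
  refine Finset.sum_congr rfl fun m _ => ?_
  have he : p.eval (μ m) = c m :=
    Lagrange.eval_interpolate_at_node c hμ.injOn (Finset.mem_univ m)
  rw [hA, ← he, Polynomial.eval_eq_sum_range' hdeg, Finset.sum_mul, Finset.sum_smul]
  refine Finset.sum_congr rfl fun k _ => ?_
  rw [Matrix.smul_mul, hTk, smul_smul]

theorem stmt13
    {V : Type*} [Fintype V] [DecidableEq V] [Nonempty V]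
    (hN : 2 ≤ Fintype.card V)
    {d M : ℕ} (hd : 1 ≤ d) (hM : 1 ≤ M)
    (S : Fin d → Matrix V V ℝ)
    (hSsym : ∀ l, (S l)ᵀ = S l)
    (hScomm : ∀ l l', S l * S l' = S l' * S l)
    (γ : Fin M → Fin d → ℝ) (hγ : Function.Injective γ)
    (P : Fin M → Matrix V V ℝ)
    (hPne : ∀ m, P m ≠ 0)
    (hPsym : ∀ m, (P m)ᵀ = P m)
    (hPidem : ∀ m, P m * P m = P m)
    (hPorth : ∀ m m', m ≠ m' → P m * P m' = 0)
    (hPsum : ∑ m, P m = (1 : Matrix V V ℝ))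
    (hSP : ∀ l m, S l * P m = γ m l • P m)
    (hPS : ∀ l m, P m * S l = γ m l • P m)
    (a : Fin d → ℝ)
    (hμ : Function.Injective fun m : Fin M => ∑ l, a l * γ m l)
    (U : Submodule ℝ (V → ℝ)) :
    ((∀ l : Fin d, ∀ x ∈ U, (S l) *ᵥ x ∈ U) ↔
      ∃ r : ℕ, 1 ≤ r ∧ ∃ φ : Fin r → V → ℝ, U = gsisSpan S φ)
    ∧ ((∀ l : Fin d, ∀ x ∈ U, (S l) *ᵥ x ∈ U) ↔
      ∃ r : ℕ, 1 ≤ r ∧ ∃ φ : Fin r → V → ℝ,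
        U = Submodule.span ℝ
          { y | ∃ k < M, ∃ i : Fin r, y = ((∑ l, a l • S l) ^ k) *ᵥ φ i }) := by
  obtain ⟨r, hr, φ, hφ⟩ := exists_gen_aux U
  have hmem : ∀ i, φ i ∈ U := fun i => hφ ▸ Submodule.subset_span ⟨i, rfl⟩
  have inv_span : ∀ (G : Set (V → ℝ)) (A : Matrix V V ℝ),
      (∀ y ∈ G, A *ᵥ y ∈ Submodule.span ℝ G) →
      ∀ x ∈ Submodule.span ℝ G, A *ᵥ x ∈ Submodule.span ℝ G := by
    intro G A h x hx
    have : Submodule.span ℝ G ≤ (Submodule.span ℝ G).comap A.mulVecLin :=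
      Submodule.span_le.2 (fun y hy => h y hy)
    exact this hx
  refine ⟨⟨fun hU => ⟨r, hr, φ, ?_⟩, ?_⟩, ⟨fun hU => ⟨r, hr, φ, ?_⟩, ?_⟩⟩
  · apply le_antisymm
    · conv_lhs => rw [← hφ]
      refine Submodule.span_mono ?_
      rintro _ ⟨i, rfl⟩
      exact ⟨fun _ => 0, i, by rw [Spow_zero_aux, Matrix.one_mulVec]⟩
    · refine Submodule.span_le.2 ?_
      rintro _ ⟨α, i, rfl⟩
      exact Spow_mem_aux S U hU α _ (hmem i)
  · rintro ⟨r, -, φ, rfl⟩ l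
    apply inv_span
    rintro _ ⟨α, i, rfl⟩
    obtain ⟨β, hβ⟩ := mul_Spow_aux S hScomm α l
    rw [Matrix.mulVec_mulVec, hβ]
    exact Submodule.subset_span ⟨β, i, rfl⟩
  · apply le_antisymm
    · conv_lhs => rw [← hφ]
      refine Submodule.span_mono ?_
      rintro _ ⟨i, rfl⟩
      exact ⟨0, hM, i, by rw [pow_zero, Matrix.one_mulVec]⟩
    · refine Submodule.span_le.2 ?_
      rintro _ ⟨k, -, i, rfl⟩
      induction k with
      | zero => simpa using hmem i
      | succ k ih =>
        rw [pow_succ', ← Matrix.mulVec_mulVec, Matrix.sum_mulVec]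
        refine Submodule.sum_mem _ fun l _ => ?_
        rw [Matrix.smul_mulVec]
        exact Submodule.smul_mem _ _ (hU l _ ih)
  · rintro ⟨r, -, φ, rfl⟩ l
    apply inv_span
    rintro _ ⟨k, -, i, rfl⟩
    have hT : ∀ m, (∑ l, a l • S l) * P m = (∑ l, a l * γ m l) • P m := by
      intro m
      rw [Finset.sum_mul, Finset.sum_smul]
      refine Finset.sum_congr rfl fun l _ => ?_
      rw [Matrix.smul_mul, hSP, smul_smul]
    have hTk : ∀ m, (∑ l, a l • S l) ^ k * P m = (∑ l, a l * γ m l) ^ k • P m := by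
      intro m
      induction k with
      | zero => simp
      | succ k ih => rw [pow_succ, mul_assoc, hT, Matrix.mul_smul, ih, smul_smul, pow_succ']
    obtain ⟨b, hb⟩ := interp_aux hM P hPsum (∑ l, a l • S l) (fun m => ∑ l, a l * γ m l)
      (fun m => (∑ l, a l * γ m l) ^ k * γ m l) hμ hT (S l * (∑ l, a l • S l) ^ k) (by
        intro m
        rw [mul_assoc, hTk, Matrix.mul_smul, hSP, smul_smul])
    rw [Matrix.mulVec_mulVec, hb, Matrix.sum_mulVec]
    refine Submodule.sum_mem _ fun j hj => ?_
    rw [Matrix.smul_mulVec]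
    exact Submodule.smul_mem _ _ (Submodule.subset_span ⟨j, Finset.mem_range.1 hj, i, rfl⟩)
end

section
/- Let U ⊆ ℝ^V be a nonzero shift-invariant subspace and let D = max_{1 ≤ m ≤ M} dim(U ∩ W_m). Then D is the length of U, i.e., the minimal number of generators of U as a shift-invariant space: (a) there exist graph signals φ_1, …, φ_D ∈ ℝ^V with U = S(φ_1,…,φ_D); and (b) whenever U = S(φ_1,…,φ_r) for some r ≥ 1 and graph signals φ_1, …, φ_r ∈ ℝ^V, one has r ≥ D. -/
open Matrix

theorem aux_P_prod {V : Type*} [Fintype V] [DecidableEq V] (P : Matrix V V ℝ) :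
    ∀ {d : ℕ} (f : Fin d → Matrix V V ℝ) (c : Fin d → ℝ),
      (∀ l, P * f l = c l • P) → P * (List.ofFn f).prod = (∏ l, c l) • P := by
  intro d
  induction d with
  | zero => intro f c h; simp
  | succ n ih =>
    intro f c h
    rw [List.ofFn_succ, List.prod_cons, ← mul_assoc, h 0, smul_mul_assoc,
      ih (fun i => f i.succ) (fun i => c i.succ) (fun l => h l.succ), Fin.prod_univ_succ, smul_smul]

theorem aux_P_pow {V : Type*} [Fintype V] [DecidableEq V] (P A : Matrix V V ℝ) (c : ℝ)
    (h : P * A = c • P) (n : ℕ) : P * A ^ n = c ^ n • P := by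
  induction n with
  | zero => simp
  | succ n ih => rw [pow_succ, ← mul_assoc, ih, smul_mul_assoc, h, smul_smul, pow_succ]

theorem aux_P_Spow {V : Type*} [Fintype V] [DecidableEq V] {d : ℕ} (P : Matrix V V ℝ)
    (S : Fin d → Matrix V V ℝ) (c : Fin d → ℝ) (h : ∀ l, P * S l = c l • P) (α : Fin d → ℕ) :
    P * Spow S α = (∏ l, c l ^ α l) • P :=
  aux_P_prod P _ _ (fun l => aux_P_pow P (S l) (c l) (h l) (α l))

theorem aux_ext {V : Type*} [Fintype V] [DecidableEq V] {M : ℕ} (P : Fin M → Matrix V V ℝ)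
    (hPsum : ∑ m, P m = (1 : Matrix V V ℝ)) (A B : Matrix V V ℝ)
    (h : ∀ m, P m * A = P m * B) : A = B := by
  rw [← one_mul A, ← one_mul B, ← hPsum, Finset.sum_mul, Finset.sum_mul]
  exact Finset.sum_congr rfl fun m _ => h m

theorem aux_S_Spow {V : Type*} [Fintype V] [DecidableEq V] {d M : ℕ}
    (S : Fin d → Matrix V V ℝ) (γ : Fin M → Fin d → ℝ) (P : Fin M → Matrix V V ℝ)
    (hPsum : ∑ m, P m = (1 : Matrix V V ℝ))
    (hPS : ∀ l m, P m * S l = γ m l • P m) (l : Fin d) (α : Fin d → ℕ) :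
    S l * Spow S α = Spow S (α + Pi.single l 1) := by
  apply aux_ext P hPsum
  intro m
  rw [← mul_assoc, hPS, smul_mul_assoc, aux_P_Spow (P m) S (γ m) (fun l => hPS l m),
    aux_P_Spow (P m) S (γ m) (fun l => hPS l m), smul_smul]
  congr 1
  simp only [Pi.add_apply, pow_add, Finset.prod_mul_distrib]
  rw [mul_comm]
  congr 1
  rw [Finset.prod_eq_single l]
  · simp
  · intro b _ hb; simp [Pi.single_eq_of_ne hb]
  · simp

theorem aux_sum {V : Type*} [Fintype V] [DecidableEq V] {M : ℕ} (P : Fin M → Matrix V V ℝ)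
    (hPsum : ∑ m, P m = (1 : Matrix V V ℝ)) (x : V → ℝ) : x = ∑ m, P m *ᵥ x := by
  rw [← Matrix.sum_mulVec, hPsum, one_mulVec]

theorem aux_proj {V : Type*} [Fintype V] [DecidableEq V] {d M : ℕ}
    (S : Fin d → Matrix V V ℝ) (γ : Fin M → Fin d → ℝ) (hγ : Function.Injective γ)
    (P : Fin M → Matrix V V ℝ)
    (hPsum : ∑ m, P m = (1 : Matrix V V ℝ))
    (hPS : ∀ l m, P m * S l = γ m l • P m)
    (U : Submodule ℝ (V → ℝ))
    (hU : ∀ l : Fin d, ∀ x ∈ U, (S l) *ᵥ x ∈ U) (m : Fin M) (x : V → ℝ) (hx : x ∈ U) :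
    P m *ᵥ x ∈ U := by
  have key : ∀ s : Finset (Fin M), m ∉ s →
      ∃ y ∈ U, P m *ᵥ y = P m *ᵥ x ∧ ∀ a ∈ s, P a *ᵥ y = 0 := by
    intro s
    induction s using Finset.induction_on with
    | empty => intro _; exact ⟨x, hx, rfl, by simp⟩
    | insert a s ha ih =>
      intro hm
      rw [Finset.mem_insert, not_or] at hm
      obtain ⟨y, hy, h1, h2⟩ := ih hm.2
      obtain ⟨l, hl⟩ : ∃ l, γ m l ≠ γ a l := by
        by_contra hcon
        push Not at hcon
        exact hm.1 (hγ (funext hcon))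
      have hl' : γ m l - γ a l ≠ 0 := sub_ne_zero.2 hl
      have hc : ∀ b, P b *ᵥ ((γ m l - γ a l)⁻¹ • (S l *ᵥ y - γ a l • y))
          = ((γ m l - γ a l)⁻¹ * (γ b l - γ a l)) • (P b *ᵥ y) := by
        intro b
        rw [mulVec_smul, mulVec_sub, mulVec_mulVec, hPS, mulVec_smul, smul_mulVec, ← sub_smul,
          smul_smul]
      refine ⟨_, U.smul_mem (γ m l - γ a l)⁻¹ (U.sub_mem (hU l y hy) (U.smul_mem (γ a l) hy)), ?_, ?_⟩
      · rw [hc, inv_mul_cancel₀ hl', one_smul, h1]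
      · intro b hb
        rw [hc]
        rcases Finset.mem_insert.1 hb with rfl | hb
        · simp
        · rw [h2 b hb, smul_zero]
  obtain ⟨y, hy, h1, h2⟩ := key (Finset.univ.erase m) (by simp)
  have : y = P m *ᵥ y := by
    conv_lhs => rw [aux_sum P hPsum y]
    rw [Finset.sum_eq_single m]
    · intro b _ hb
      exact h2 b (by simp [hb])
    · simp
  rw [← h1, ← this]
  exact hy

theorem aux_Spow_mem {V : Type*} [Fintype V] [DecidableEq V] (U : Submodule ℝ (V → ℝ)) :
    ∀ {d : ℕ} (f : Fin d → Matrix V V ℝ), (∀ l, ∀ x ∈ U, f l *ᵥ x ∈ U) →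
      ∀ x ∈ U, (List.ofFn f).prod *ᵥ x ∈ U := by
  intro d
  induction d with
  | zero => intro f h x hx; simpa using hx
  | succ n ih =>
    intro f h x hx
    rw [List.ofFn_succ, List.prod_cons, ← mulVec_mulVec]
    exact h 0 _ (ih _ (fun l => h l.succ) x hx)

theorem aux_pow_mem {V : Type*} [Fintype V] [DecidableEq V] (U : Submodule ℝ (V → ℝ))
    (A : Matrix V V ℝ) (h : ∀ x ∈ U, A *ᵥ x ∈ U) (n : ℕ) : ∀ x ∈ U, A ^ n *ᵥ x ∈ U := by
  induction n with
  | zero => intro x hx; simpa using hx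
  | succ n ih => intro x hx; rw [pow_succ, ← mulVec_mulVec]; exact ih _ (h x hx)

theorem aux_gens {E : Type*} [AddCommGroup E] [Module ℝ E] (W : Submodule ℝ E)
    [FiniteDimensional ℝ W] (D : ℕ) (hD : Module.finrank ℝ W ≤ D) :
    ∃ g : Fin D → E, (∀ i, g i ∈ W) ∧ W ≤ Submodule.span ℝ (Set.range g) := by
  let b := Module.finBasis ℝ W
  refine ⟨fun i => if h : i.1 < Module.finrank ℝ W then (b ⟨i.1, h⟩ : E) else 0, ?_, ?_⟩
  · intro i
    dsimp only
    split_ifs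
    · exact Submodule.coe_mem _
    · exact W.zero_mem
  · intro x hx
    have h1 := congrArg W.subtype (b.sum_repr ⟨x, hx⟩)
    rw [map_sum] at h1
    simp only [map_smul, Submodule.subtype_apply] at h1
    rw [← h1]
    refine Submodule.sum_mem _ fun j _ => Submodule.smul_mem _ _ (Submodule.subset_span ?_)
    exact ⟨⟨j.1, j.2.trans_le hD⟩, by simp⟩

theorem stmt14
    {V : Type*} [Fintype V] [DecidableEq V] [Nonempty V]
    (hN : 2 ≤ Fintype.card V)
    {d M : ℕ} (hd : 1 ≤ d) (hM : 1 ≤ M)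
    (S : Fin d → Matrix V V ℝ)
    (hSsym : ∀ l, (S l)ᵀ = S l)
    (hScomm : ∀ l l', S l * S l' = S l' * S l)
    (γ : Fin M → Fin d → ℝ) (hγ : Function.Injective γ)
    (P : Fin M → Matrix V V ℝ)
    (hPne : ∀ m, P m ≠ 0)
    (hPsym : ∀ m, (P m)ᵀ = P m)
    (hPidem : ∀ m, P m * P m = P m)
    (hPorth : ∀ m m', m ≠ m' → P m * P m' = 0)
    (hPsum : ∑ m, P m = (1 : Matrix V V ℝ))
    (hSP : ∀ l m, S l * P m = γ m l • P m)
    (hPS : ∀ l m, P m * S l = γ m l • P m)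
    (U : Submodule ℝ (V → ℝ))
    (hU : ∀ l : Fin d, ∀ x ∈ U, (S l) *ᵥ x ∈ U)
    (hU0 : U ≠ ⊥) :
    ∀ D : ℕ,
      D = (Finset.univ.sup fun m : Fin M =>
        Module.finrank ℝ ↥(U ⊓ LinearMap.range (P m).mulVecLin)) →
      ((∃ φ : Fin D → V → ℝ, U = gsisSpan S φ) ∧
        ∀ (r : ℕ) (φ : Fin r → V → ℝ), 1 ≤ r → U = gsisSpan S φ → D ≤ r) := by
  intro D hD
  constructor
  · have hg : ∀ m, ∃ g : Fin D → V → ℝ,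
        (∀ i, g i ∈ U ⊓ LinearMap.range (P m).mulVecLin) ∧
        U ⊓ LinearMap.range (P m).mulVecLin ≤ Submodule.span ℝ (Set.range g) := by
      intro m
      apply aux_gens
      rw [hD]
      exact Finset.le_sup (f := fun m : Fin M =>
        Module.finrank ℝ ↥(U ⊓ LinearMap.range (P m).mulVecLin)) (Finset.mem_univ m)
    choose g hg1 hg2 using hg
    have hPg : ∀ m m' i, P m *ᵥ g m' i = if m' = m then g m i else 0 := by
      intro m m' i
      obtain ⟨z, hz⟩ := (hg1 m' i).2
      rw [mulVecLin_apply] at hz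
      rw [← hz, mulVec_mulVec]
      split_ifs with h
      · subst h
        rw [hPidem, hz]
      · rw [hPorth m m' (Ne.symm h), zero_mulVec]
    refine ⟨fun i => ∑ m, g m i, le_antisymm ?_ ?_⟩
    · have hinv : ∀ l, ∀ x ∈ gsisSpan S (fun i => ∑ m, g m i),
          S l *ᵥ x ∈ gsisSpan S (fun i => ∑ m, g m i) := by
        intro l x hx
        have hle : gsisSpan S (fun i => ∑ m, g m i) ≤
            (gsisSpan S (fun i => ∑ m, g m i)).comap (S l).mulVecLin := by
          conv_lhs => unfold gsisSpan
          rw [Submodule.span_le]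
          rintro y ⟨α, i, rfl⟩
          refine Submodule.subset_span ⟨α + Pi.single l 1, i, ?_⟩
          rw [mulVecLin_apply, mulVec_mulVec, aux_S_Spow S γ P hPsum hPS]
        exact hle hx
      intro x hx
      rw [aux_sum P hPsum x]
      refine Submodule.sum_mem _ fun m _ => ?_
      have h1 : P m *ᵥ x ∈ U ⊓ LinearMap.range (P m).mulVecLin :=
        ⟨aux_proj S γ hγ P hPsum hPS U hU m x hx, ⟨x, rfl⟩⟩
      refine (Submodule.span_le.2 ?_) (hg2 m h1)
      rintro _ ⟨i, rfl⟩
      have h2 : P m *ᵥ (∑ m', g m' i) = g m i := by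
        rw [Matrix.mulVec_sum]
        simp [hPg]
      rw [← h2]
      apply aux_proj S γ hγ P hPsum hPS _ hinv
      refine Submodule.subset_span ⟨0, i, ?_⟩
      simp [Spow]
    · unfold gsisSpan
      rw [Submodule.span_le]
      rintro y ⟨α, i, rfl⟩
      exact aux_Spow_mem U _ (fun l => aux_pow_mem U _ (hU l) _) _
        (Submodule.sum_mem _ fun m _ => (hg1 m i).1)
  · intro r φ _ hφ
    rw [hD]
    refine Finset.sup_le fun m _ => ?_
    have hle : U ⊓ LinearMap.range (P m).mulVecLin ≤
        Submodule.span ℝ (Set.range fun i => P m *ᵥ φ i) := by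
      rintro x ⟨hx, z, hz⟩
      rw [mulVecLin_apply] at hz
      have hx' : P m *ᵥ x = x := by rw [← hz, mulVec_mulVec, hPidem]
      have hle2 : U ≤ (Submodule.span ℝ (Set.range fun i => P m *ᵥ φ i)).comap
          (P m).mulVecLin := by
        rw [hφ]
        unfold gsisSpan
        rw [Submodule.span_le]
        rintro y ⟨α, i, rfl⟩
        rw [SetLike.mem_coe, Submodule.mem_comap]
        rw [mulVecLin_apply, mulVec_mulVec, aux_P_Spow (P m) S (γ m) (fun l => hPS l m),
          smul_mulVec]
        exact Submodule.smul_mem _ _ (Submodule.subset_span ⟨i, rfl⟩)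
      rw [← hx']
      exact hle2 hx
    calc _ ≤ _ := Submodule.finrank_mono hle
      _ ≤ Fintype.card (Fin r) := finrank_range_le_card _
      _ = r := Fintype.card_fin r
end

section
/- Let d ≥ 1 and M ≥ 1 be integers and let γ(1), …, γ(M) ∈ ℝ^d be pairwise distinct vectors, with components γ_l(m), satisfying |γ_l(m)| < 1 for all 1 ≤ l ≤ d and 1 ≤ m ≤ M. Then the M×M real matrix A with entries A(m,m') = ∏_{l=1}^{d} (1 − γ_l(m) γ_l(m'))⁻¹ is invertible (nonsingular). -/
theorem hasSum_monomials : ∀ {d : ℕ} (x : Fin d → ℝ) (_ : ∀ l, |x l| < 1),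
    HasSum (fun α : Fin d → ℕ => ∏ l, x l ^ α l) (∏ l, (1 - x l)⁻¹) := by
  intro d
  induction d with
  | zero =>
    intro x _
    simp
  | succ n ih =>
    intro x hx
    have h1 := hasSum_geometric_of_abs_lt_one (hx 0)
    have h2 := ih (fun l => x l.succ) (fun l => hx _)
    have hs1 : Summable fun k : ℕ => ‖x 0 ^ k‖ := h1.summable.norm
    have hs2 : Summable fun α : Fin n → ℕ => ‖∏ l, x l.succ ^ α l‖ := h2.summable.norm
    have hs3 : Summable fun p : ℕ × (Fin n → ℕ) => x 0 ^ p.1 * ∏ l, x l.succ ^ p.2 l :=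
      summable_mul_of_summable_norm (f := fun k : ℕ => x 0 ^ k)
        (g := fun α : Fin n → ℕ => ∏ l, x l.succ ^ α l) hs1 hs2
    have h3 := HasSum.mul h1 h2 hs3
    rw [Fin.prod_univ_succ, ← (Fin.consEquiv (fun _ : Fin (n+1) => ℕ)).hasSum_iff]
    refine Eq.mp (congrArg (fun f => HasSum f _) (funext fun p => ?_)) h3
    symm
    simp [Fin.prod_univ_succ, Fin.consEquiv]

/-- The monomial evaluation character attached to a point. -/
noncomputable def monomialChar {d : ℕ} (x : Fin d → ℝ) : Multiplicative (Fin d → ℕ) →* ℝ where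
  toFun α := ∏ l, x l ^ (Multiplicative.toAdd α l)
  map_one' := by simp
  map_mul' a b := by simp [pow_add, Finset.prod_mul_distrib]

theorem monomialChar_injective {d : ℕ} : Function.Injective (monomialChar (d := d)) := by
  intro x y h
  ext l
  have := DFunLike.congr_fun h (Multiplicative.ofAdd (Pi.single l 1))
  simpa [monomialChar, Pi.single_apply, pow_ite] using this

theorem stmt15 {d M : ℕ} (hd : 1 ≤ d) (hM : 1 ≤ M)
    (γ : Fin M → Fin d → ℝ) (hγ : Function.Injective γ)
    (hbound : ∀ m l, |γ m l| < 1) :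
    IsUnit (Matrix.of fun m m' : Fin M => ∏ l, (1 - γ m l * γ m' l)⁻¹) := by
  rw [← Matrix.mulVec_injective_iff_isUnit]
  rw [← Matrix.coe_mulVecLin, ← LinearMap.ker_eq_bot, LinearMap.ker_eq_bot']
  intro v hv
  rw [Matrix.mulVecLin_apply] at hv
  have hs : HasSum (fun α : Fin d → ℕ => (∑ m, v m * ∏ l, γ m l ^ α l) ^ 2)
      (∑ m, ∑ m', v m * v m' * ∏ l, (1 - γ m l * γ m' l)⁻¹) := by
    have h := hasSum_sum (s := Finset.univ) fun (m : Fin M) _ =>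
      hasSum_sum (s := Finset.univ) fun (m' : Fin M) _ =>
      (hasSum_monomials (fun l => γ m l * γ m' l) (fun l => by
        rw [abs_mul]
        exact mul_lt_one_of_nonneg_of_lt_one_left (abs_nonneg _) (hbound m l)
          (hbound m' l).le)).mul_left (v m * v m')
    refine Eq.mp (congrArg (fun f => HasSum f _) (funext fun α => ?_)) h
    symm
    rw [sq, Finset.sum_mul_sum]
    refine Finset.sum_congr rfl fun m _ => Finset.sum_congr rfl fun m' _ => ?_
    simp only [mul_pow, Finset.prod_mul_distrib]
    ring
  have h0 : (∑ m, ∑ m', v m * v m' * ∏ l, (1 - γ m l * γ m' l)⁻¹) = 0 := by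
    refine Finset.sum_eq_zero fun m _ => ?_
    have := congrFun hv m
    simp only [Matrix.mulVec, dotProduct, Matrix.of_apply, Pi.zero_apply] at this
    rw [← mul_zero (v m), ← this, Finset.mul_sum]
    exact Finset.sum_congr rfl fun m' _ => by ring
  rw [h0, hasSum_zero_iff_of_nonneg (fun _ => sq_nonneg _)] at hs
  have hli := (linearIndependent_monoidHom (Multiplicative (Fin d → ℕ)) ℝ).comp
    (fun m => monomialChar (γ m)) (monomialChar_injective.comp hγ)
  rw [Fintype.linearIndependent_iff] at hli
  funext m
  refine hli v ?_ m
  ext α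
  have := congrFun hs (Multiplicative.toAdd α)
  simpa [monomialChar] using this
end

section
/- Let φ_1, …, φ_r ∈ ℝ^V and let a ∈ ℝ^d be such that the numbers μ(m) = Σ_{l=1}^d a_l γ_l(m), 1 ≤ m ≤ M, are pairwise distinct; set T = Σ_{l=1}^d a_l S_l. Then the family ( T^k φ_i )_{0 ≤ k ≤ M−1, 1 ≤ i ≤ r} is a basis of S(φ_1,…,φ_r) (i.e., it is linearly independent and its span equals S(φ_1,…,φ_r)) if and only if dim( S(φ_1,…,φ_r) ∩ W_m ) = r for every 1 ≤ m ≤ M. -/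
open Matrix

theorem aux_prod {V : Type*} [Fintype V] [DecidableEq V] {n : ℕ}
    (Q : Matrix V V ℝ) (A : Fin n → Matrix V V ℝ) (c : Fin n → ℝ)
    (h : ∀ l, A l * Q = c l • Q) :
    (List.ofFn A).prod * Q = (∏ l, c l) • Q := by
  induction n with
  | zero => simp
  | succ n ih =>
    rw [List.ofFn_succ, List.prod_cons, Matrix.mul_assoc,
      ih (fun l => A l.succ) (fun l => c l.succ) (fun l => h l.succ),
      Matrix.mul_smul, h 0, smul_smul, Fin.prod_univ_succ, mul_comm]

theorem aux_pow {V : Type*} [Fintype V] [DecidableEq V]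
    (Q A : Matrix V V ℝ) (c : ℝ) (h : A * Q = c • Q) (k : ℕ) :
    A ^ k * Q = c ^ k • Q := by
  induction k with
  | zero => simp
  | succ n ih => rw [pow_succ, Matrix.mul_assoc, h, Matrix.mul_smul, ih, smul_smul, pow_succ, mul_comm]

theorem stmt18
    {V : Type*} [Fintype V] [DecidableEq V] [Nonempty V]
    (hN : 2 ≤ Fintype.card V)
    {d M : ℕ} (hd : 1 ≤ d) (hM : 1 ≤ M)
    (S : Fin d → Matrix V V ℝ)
    (hSsym : ∀ l, (S l)ᵀ = S l)
    (hScomm : ∀ l l', S l * S l' = S l' * S l)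
    (γ : Fin M → Fin d → ℝ) (hγ : Function.Injective γ)
    (P : Fin M → Matrix V V ℝ)
    (hPne : ∀ m, P m ≠ 0)
    (hPsym : ∀ m, (P m)ᵀ = P m)
    (hPidem : ∀ m, P m * P m = P m)
    (hPorth : ∀ m m', m ≠ m' → P m * P m' = 0)
    (hPsum : ∑ m, P m = (1 : Matrix V V ℝ))
    (hSP : ∀ l m, S l * P m = γ m l • P m)
    (hPS : ∀ l m, P m * S l = γ m l • P m)
    (r : ℕ) (φ : Fin r → V → ℝ)
    (a : Fin d → ℝ)
    (hμ : Function.Injective fun m : Fin M => ∑ l, a l * γ m l) :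
    (LinearIndependent ℝ
        (fun p : Fin M × Fin r => ((∑ l, a l • S l) ^ (p.1 : ℕ)) *ᵥ φ p.2) ∧
      Submodule.span ℝ
        (Set.range fun p : Fin M × Fin r => ((∑ l, a l • S l) ^ (p.1 : ℕ)) *ᵥ φ p.2)
        = gsisSpan S φ)
    ↔ ∀ m : Fin M,
        Module.finrank ℝ ↥(gsisSpan S φ ⊓ LinearMap.range (P m).mulVecLin) = r := by
  classical
  set T : Matrix V V ℝ := ∑ l, a l • S l with hT
  set μ : Fin M → ℝ := fun m => ∑ l, a l * γ m l with hμd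
  have hTP : ∀ m, T * P m = μ m • P m := by
    intro m
    rw [hT, Finset.sum_mul, hμd, Finset.sum_smul]
    refine Finset.sum_congr rfl fun l _ => ?_
    rw [Matrix.smul_mul, hSP, smul_smul]
  have hTk : ∀ k : ℕ, T ^ k = ∑ m, μ m ^ k • P m := by
    intro k
    calc T ^ k = T ^ k * ∑ m, P m := by rw [hPsum, Matrix.mul_one]
      _ = _ := by
        rw [Finset.mul_sum]
        exact Finset.sum_congr rfl fun m _ => aux_pow _ _ _ (hTP m) k
  have hSpow : ∀ α : Fin d → ℕ, Spow S α = ∑ m, (∏ l, γ m l ^ α l) • P m := by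
    intro α
    calc Spow S α = Spow S α * ∑ m, P m := by rw [hPsum, Matrix.mul_one]
      _ = _ := by
        rw [Finset.mul_sum]
        exact Finset.sum_congr rfl fun m _ =>
          aux_prod _ _ _ fun l => aux_pow _ _ _ (hSP l m) _
  have hshift : ∀ (l : Fin d) (α : Fin d → ℕ),
      S l * Spow S α = Spow S (α + Pi.single l 1) := by
    intro l α
    rw [hSpow, hSpow, Finset.mul_sum]
    refine Finset.sum_congr rfl fun m _ => ?_
    rw [Matrix.mul_smul, hSP, smul_smul]
    congr 1
    simp only [Pi.add_apply, pow_add, Finset.prod_mul_distrib]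
    congr 1
    rw [Finset.prod_eq_single l]
    · simp
    · intro b _ hb
      simp [Pi.single_apply, hb]
    · simp
  have hinvS : ∀ l, ∀ x ∈ gsisSpan S φ, S l *ᵥ x ∈ gsisSpan S φ := by
    intro l
    suffices h : gsisSpan S φ ≤ (gsisSpan S φ).comap (S l).mulVecLin from fun x hx => h hx
    conv_lhs => rw [gsisSpan]
    rw [Submodule.span_le]
    rintro y ⟨α, i, rfl⟩
    simp only [SetLike.mem_coe, Submodule.mem_comap, Matrix.mulVecLin_apply, Matrix.mulVec_mulVec]
    rw [hshift]
    exact Submodule.subset_span ⟨_, i, rfl⟩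
  have hinvT : ∀ x ∈ gsisSpan S φ, T *ᵥ x ∈ gsisSpan S φ := by
    intro x hx
    rw [hT, Matrix.sum_mulVec]
    refine Submodule.sum_mem _ fun l _ => ?_
    rw [Matrix.smul_mulVec]
    exact Submodule.smul_mem _ _ (hinvS l x hx)
  have hφ : ∀ i, φ i ∈ gsisSpan S φ := by
    intro i
    refine Submodule.subset_span ⟨0, i, ?_⟩
    simp [hSpow, hPsum]
  set f : Fin M × Fin r → V → ℝ := fun p => (T ^ (p.1 : ℕ)) *ᵥ φ p.2 with hf
  set g : Fin M × Fin r → V → ℝ := fun p => P p.1 *ᵥ φ p.2 with hg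
  have hAB : Submodule.span ℝ (Set.range f) ≤ gsisSpan S φ := by
    rw [Submodule.span_le]
    rintro _ ⟨⟨k, i⟩, rfl⟩
    simp only [hf, SetLike.mem_coe]
    generalize (k : ℕ) = n
    induction n with
    | zero => simpa using hφ i
    | succ n ih =>
      rw [pow_succ', ← Matrix.mulVec_mulVec]
      exact hinvT _ ih
  have hBC : gsisSpan S φ ≤ Submodule.span ℝ (Set.range g) := by
    rw [gsisSpan, Submodule.span_le]
    rintro y ⟨α, i, rfl⟩
    rw [hSpow, Matrix.sum_mulVec]
    refine Submodule.sum_mem _ fun m _ => ?_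
    rw [Matrix.smul_mulVec]
    exact Submodule.smul_mem _ _ (Submodule.subset_span ⟨(m, i), rfl⟩)
  have hdet : IsUnit (Matrix.vandermonde μ).det :=
    isUnit_iff_ne_zero.2 (Matrix.det_vandermonde_ne_zero_iff.2 hμ)
  have hPT : ∀ m, P m = ∑ k : Fin M, (Matrix.vandermonde μ)⁻¹ k m • T ^ (k : ℕ) := by
    intro m
    have h1 := Matrix.mul_nonsing_inv _ hdet
    simp only [hTk, Finset.smul_sum, smul_smul]
    rw [Finset.sum_comm]
    simp only [← Finset.sum_smul]
    have h2 : ∀ m', ∑ k : Fin M, (Matrix.vandermonde μ)⁻¹ k m * μ m' ^ (k : ℕ)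
        = (1 : Matrix (Fin M) (Fin M) ℝ) m' m := by
      intro m'
      rw [← h1, Matrix.mul_apply]
      exact Finset.sum_congr rfl fun k _ => by rw [Matrix.vandermonde_apply, mul_comm]
    simp [h2, Matrix.one_apply]
  have hCA : Submodule.span ℝ (Set.range g) ≤ Submodule.span ℝ (Set.range f) := by
    rw [Submodule.span_le]
    rintro _ ⟨⟨m, i⟩, rfl⟩
    simp only [hg, SetLike.mem_coe]
    rw [hPT m, Matrix.sum_mulVec]
    refine Submodule.sum_mem _ fun k _ => ?_
    rw [Matrix.smul_mulVec]
    exact Submodule.smul_mem _ _ (Submodule.subset_span ⟨(k, i), rfl⟩)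
  have eAB : Submodule.span ℝ (Set.range f) = gsisSpan S φ := le_antisymm hAB (hBC.trans hCA)
  have eBC : gsisSpan S φ = Submodule.span ℝ (Set.range g) := le_antisymm hBC (hCA.trans hAB)
  have hinter : ∀ m, gsisSpan S φ ⊓ LinearMap.range (P m).mulVecLin
      = Submodule.span ℝ (Set.range fun i => P m *ᵥ φ i) := by
    intro m
    rw [eBC]
    apply le_antisymm
    · rintro x ⟨hx, y, rfl⟩
      have h : Submodule.span ℝ (Set.range g) ≤
          (Submodule.span ℝ (Set.range fun i => P m *ᵥ φ i)).comap (P m).mulVecLin := by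
        rw [Submodule.span_le]
        rintro _ ⟨⟨m', i⟩, rfl⟩
        simp only [hg, SetLike.mem_coe, Submodule.mem_comap, Matrix.mulVecLin_apply,
          Matrix.mulVec_mulVec]
        by_cases hm : m = m'
        · subst hm
          rw [hPidem]
          exact Submodule.subset_span ⟨i, rfl⟩
        · rw [hPorth _ _ hm, Matrix.zero_mulVec]
          exact Submodule.zero_mem _
      have h3 := h hx
      simpa only [Submodule.mem_comap, Matrix.mulVecLin_apply, Matrix.mulVec_mulVec, hPidem] using h3
    · rw [Submodule.span_le]
      rintro _ ⟨i, rfl⟩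
      exact ⟨Submodule.subset_span ⟨(m, i), rfl⟩, φ i, rfl⟩
  have hLI : LinearIndependent ℝ f ↔ LinearIndependent ℝ g := by
    rw [linearIndependent_iff_card_eq_finrank_span, linearIndependent_iff_card_eq_finrank_span,
      Set.finrank, Set.finrank, eAB, eBC]
  have hLIg : LinearIndependent ℝ g ↔ ∀ m, LinearIndependent ℝ (fun i => P m *ᵥ φ i) := by
    constructor
    · intro h m
      exact h.comp (fun i => (m, i)) (fun i j hij => (Prod.mk.inj hij).2)
    · intro h
      rw [Fintype.linearIndependent_iff]
      rintro c hc ⟨m, i⟩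
      refine Fintype.linearIndependent_iff.1 (h m) (fun i => c (m, i)) ?_ i
      have h4 := congrArg (fun x => P m *ᵥ x) hc
      simp only [Matrix.mulVec_zero, Fintype.sum_prod_type, Matrix.mulVec_sum, hg,
        Matrix.mulVec_smul, Matrix.mulVec_mulVec] at h4
      rw [Finset.sum_eq_single m] at h4
      · simpa only [hPidem] using h4
      · intro b _ hb
        simp [hPorth _ _ hb.symm]
      · simp
  rw [and_iff_left eAB, hLI, hLIg]
  refine forall_congr' fun m => ?_
  rw [linearIndependent_iff_card_eq_finrank_span, hinter m, Set.finrank, Fintype.card_fin]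
  exact eq_comm
end
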